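/- Assume V and W are finite-dimensional and λ is a replacement rule. If A and B are Koszul (all their Koszul complexes are exact), then P = T(V⊕W)/(R ⊕ D_λ ⊕ S) is Koszul (all its Koszul complexes are exact). -/

import Mathlib

set_option linter.unusedSectionVars false

open TensorProduct

noncomputable section Quadratic

variable (k : Type) [Field k] [CharZero k]
variable (V : Type) [AddCommGroup V] [Module k V]

/-- Iterated tensor powers of `V`: `TP k V n = V^{⊗n}` (with `TP k V 0 = k`, `TP k V 1 = V`). -/
def TP : ℕ → ModuleCat k
  | 0 => ModuleCat.of k k
  | 1 => ModuleCat.of k V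
  | (n + 2) => ModuleCat.of k (↥(TP (n + 1)) ⊗[k] V)

/-- `V^{⊗n} ⊗ V ≅ V^{⊗(n+1)}`. -/
def stepEquiv : ∀ n : ℕ, (↥(TP k V n) ⊗[k] V) ≃ₗ[k] ↥(TP k V (n + 1))
  | 0 => TensorProduct.lid k V
  | (n + 1) => LinearEquiv.refl k ↥(TP k V (n + 2))

/-- The concatenation isomorphism `V^{⊗p} ⊗ V^{⊗q} ≅ V^{⊗(p+q)}`. -/
def concatEquiv : ∀ p q : ℕ, (↥(TP k V p) ⊗[k] ↥(TP k V q)) ≃ₗ[k] ↥(TP k V (p + q))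
  | p, 0 => TensorProduct.rid k ↥(TP k V p)
  | p, 1 => stepEquiv k V p
  | p, (q + 2) =>
      (TensorProduct.assoc k ↥(TP k V p) ↥(TP k V (q + 1)) V).symm.trans
        ((TensorProduct.congr (concatEquiv p (q + 1)) (LinearEquiv.refl k V)).trans
          (stepEquiv k V (p + (q + 1))))

/-- Transport of submodules along an equality of tensor-power indices. -/
def castTP {m n : ℕ} (h : m = n) (S : Submodule k ↥(TP k V m)) : Submodule k ↥(TP k V n) :=
  h ▸ S

/-- For `S ⊆ V^{⊗p}` and `T ⊆ V^{⊗q}`, the subspace `S ⊗ T ⊆ V^{⊗(p+q)}`. -/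
def concatSub {p q : ℕ} (S : Submodule k ↥(TP k V p)) (T : Submodule k ↥(TP k V q)) :
    Submodule k ↥(TP k V (p + q)) :=
  Submodule.map (concatEquiv k V p q).toLinearMap
    (LinearMap.range (TensorProduct.map S.subtype T.subtype))

variable (R : Submodule k ↥(TP k V 2))

/-- The subspace `V^{⊗i} ⊗ R ⊗ V^{⊗j}` of `V^{⊗(i+2+j)}`. -/
def relTerm (i j : ℕ) : Submodule k ↥(TP k V (i + 2 + j)) :=
  castTP k V (by omega)
    (concatSub k V (⊤ : Submodule k ↥(TP k V i)) (concatSub k V R (⊤ : Submodule k ↥(TP k V j))))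

/-- The weight-`d` part `Σ_{i=0}^{d−2} V^{⊗i} ⊗ R ⊗ V^{⊗(d−2−i)}` of the ideal generated by `R`,
so that the weight-`d` piece of the quadratic algebra `A = T(V)/(R)` is `A_d = V^{⊗d}/RelOf d`. -/
def RelOf (d : ℕ) : Submodule k ↥(TP k V d) :=
  ⨆ i : Fin (d - 1), castTP k V (by have := i.isLt; omega) (relTerm k V R i (d - 2 - i))

/-- The weight-`d` component of the Koszul dual of `A = T(V)/(R)`:
`A^¡_0 = k`, `A^¡_1 = V` and `A^¡_d = ⋂_{i=0}^{d−2} V^{⊗i} ⊗ R ⊗ V^{⊗(d−2−i)}` for `d ≥ 2`. -/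
def Dual (d : ℕ) : Submodule k ↥(TP k V d) :=
  ⨅ i : Fin (d - 1), castTP k V (by have := i.isLt; omega) (relTerm k V R i (d - 2 - i))

/-- The numerator `A^¡_d ⊗ V^{⊗(ρ−d)}` of the `d`-th term of the Koszul complex of weight `ρ`
(the `d`-th term of the Koszul complex is `A^¡_d ⊗ A_{ρ−d} = Kt ρ d / Kr ρ d`, with all terms
realized as subquotients of `V^{⊗ρ}` along the canonical identifications; the differentials are
then all induced by the identity of `V^{⊗ρ}`). -/
def Kt (ρ d : ℕ) : Submodule k ↥(TP k V ρ) :=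
  if h : d ≤ ρ then
    castTP k V (by omega) (concatSub k V (Dual k V R d) (⊤ : Submodule k ↥(TP k V (ρ - d))))
  else ⊥

/-- The denominator `A^¡_d ⊗ (RelOf (ρ−d))` of the `d`-th term of the Koszul complex of weight
`ρ`, so that this term is `A^¡_d ⊗ A_{ρ−d} = Kt ρ d / Kr ρ d`. -/
def Kr (ρ d : ℕ) : Submodule k ↥(TP k V ρ) :=
  if h : d ≤ ρ then
    castTP k V (by omega) (concatSub k V (Dual k V R d) (RelOf k V R (ρ - d)))
  else ⊥

/-- `A = T(V)/(R)` is Koszul: for every weight `ρ ≥ 1` the Koszul complex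
`0 → A^¡_ρ → A^¡_{ρ−1} ⊗ A_1 → ⋯ → A^¡_1 ⊗ A_{ρ−1} → A_ρ → 0`
is exact.  Realizing the `d`-th term as the subquotient `Kt ρ d / Kr ρ d` of `V^{⊗ρ}` (with the
differentials induced by the identity of `V^{⊗ρ}`), exactness at the `d`-th term reads
`Kt ρ d ⊓ Kr ρ (d−1) = Kr ρ d ⊔ Kt ρ (d+1)` (at `d = 0` the kernel of the outgoing map is
everything, whence the `if`). -/
def IsKoszul : Prop :=
  ∀ ρ ≥ 1, ∀ d ≤ ρ,
    Kt k V R ρ d ⊓ (if d = 0 then ⊤ else Kr k V R ρ (d - 1)) =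
      Kr k V R ρ d ⊔ Kt k V R ρ (d + 1)

variable (W : Type) [AddCommGroup W] [Module k W]

/-- Functoriality of tensor powers: a linear map `f : M → N` induces `f^{⊗n} : M^{⊗n} → N^{⊗n}`. -/
def TPmap {M N : Type} [AddCommGroup M] [Module k M] [AddCommGroup N] [Module k N]
    (f : M →ₗ[k] N) : ∀ n : ℕ, ↥(TP k M n) →ₗ[k] ↥(TP k N n)
  | 0 => LinearMap.id
  | 1 => f
  | (n + 2) => TensorProduct.map (TPmap f (n + 1)) f

/-- The canonical identification `M ⊗ M ≅ TP k M 2`. -/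
def toTP2 (M : Type) [AddCommGroup M] [Module k M] : (M ⊗[k] M) ≃ₗ[k] ↥(TP k M 2) :=
  concatEquiv k M 1 1

/-- The image of `R ⊆ V ⊗ V` in `(V ⊕ W)^{⊗2}`. -/
def embRR (R : Submodule k (V ⊗[k] V)) : Submodule k ↥(TP k (V × W) 2) :=
  Submodule.map ((toTP2 k (V × W)).toLinearMap ∘ₗ
    TensorProduct.map (LinearMap.inl k V W) (LinearMap.inl k V W)) R

/-- The image of `S ⊆ W ⊗ W` in `(V ⊕ W)^{⊗2}`. -/
def embSS (S : Submodule k (W ⊗[k] W)) : Submodule k ↥(TP k (V × W) 2) :=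
  Submodule.map ((toTP2 k (V × W)).toLinearMap ∘ₗ
    TensorProduct.map (LinearMap.inr k V W) (LinearMap.inr k V W)) S

/-- The graph `D_λ = { x − λ(x) : x ∈ W ⊗ V } ⊆ (V ⊕ W)^{⊗2}` of a linear map
`λ : W ⊗ V → V ⊗ W`. -/
def embD (lam : (W ⊗[k] V) →ₗ[k] (V ⊗[k] W)) : Submodule k ↥(TP k (V × W) 2) :=
  LinearMap.range
    (((toTP2 k (V × W)).toLinearMap ∘ₗ
        TensorProduct.map (LinearMap.inr k V W) (LinearMap.inl k V W) :
        (W ⊗[k] V) →ₗ[k] ↥(TP k (V × W) 2))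
      - ((toTP2 k (V × W)).toLinearMap ∘ₗ
          TensorProduct.map (LinearMap.inl k V W) (LinearMap.inr k V W)) ∘ₗ lam)

/-- The quadratic relations `R ⊕ D_λ ⊕ S ⊆ (V ⊕ W)^{⊗2}` of `P = T(V⊕W)/(R ⊕ D_λ ⊕ S)`. -/
def relP (R : Submodule k (V ⊗[k] V)) (S : Submodule k (W ⊗[k] W))
    (lam : (W ⊗[k] V) →ₗ[k] (V ⊗[k] W)) : Submodule k ↥(TP k (V × W) 2) :=
  embRR k V W R ⊔ embD k V W lam ⊔ embSS k V W S

variable (R : Submodule k (V ⊗[k] V)) (S : Submodule k (W ⊗[k] W))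
variable (lam : (W ⊗[k] V) →ₗ[k] (V ⊗[k] W))

/-- The map `A_a ⊗ B_b → P_{a+b}` induced by multiplication in `P` (on representatives: the word
`v₁⋯v_a ⊗ w₁⋯w_b` of `V^{⊗a} ⊗ W^{⊗b}` is sent to the class of its concatenation in
`P_{a+b} = (V⊕W)^{⊗(a+b)}/RelOf (a+b)`). -/
def multVW (a b : ℕ) :
    (↥(TP k V a) ⊗[k] ↥(TP k W b)) →ₗ[k]
      (↥(TP k (V × W) (a + b)) ⧸ RelOf k (V × W) (relP k V W R S lam) (a + b)) :=
  (RelOf k (V × W) (relP k V W R S lam) (a + b)).mkQ ∘ₗ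
    (concatEquiv k (V × W) a b).toLinearMap ∘ₗ
    TensorProduct.map (TPmap k (LinearMap.inl k V W) a) (TPmap k (LinearMap.inr k V W) b)

/-- The canonical kernel of the map `V^{⊗a} ⊗ W^{⊗b} → A_a ⊗ B_b`, namely
`(Rel_A a) ⊗ W^{⊗b} + V^{⊗a} ⊗ (Rel_B b)`; the multiplication map `A_a ⊗ B_b → P_{a+b}` is
injective precisely when the kernel of `multVW a b` equals it. -/
def denVW (a b : ℕ) : Submodule k (↥(TP k V a) ⊗[k] ↥(TP k W b)) :=
  LinearMap.range (LinearMap.rTensor ↥(TP k W b)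
      (RelOf k V (Submodule.map (toTP2 k V).toLinearMap R) a).subtype) ⊔
    LinearMap.range (LinearMap.lTensor ↥(TP k V a)
      (RelOf k W (Submodule.map (toTP2 k W).toLinearMap S) b).subtype)

/-- `λ` is a replacement rule: the two maps `A_1 ⊗ B_2 → P_3` and `A_2 ⊗ B_1 → P_3` induced by
multiplication in `P` are injective. -/
def IsReplacementRule : Prop :=
  LinearMap.ker (multVW k V W R S lam 1 2) = denVW k V W R S 1 2 ∧
  LinearMap.ker (multVW k V W R S lam 2 1) = denVW k V W R S 2 1

namespace QuadraticKoszul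

section TensorPowers

variable {k : Type} [Field k] {U : Type} [AddCommGroup U] [Module k U]

/-- The identification `U^{⊗0} = k`. -/
def zeroEquiv : ↥(TP k U 0) ≃ₗ[k] k := LinearEquiv.refl k k

/-- The identification `U = U^{⊗1}`. -/
def oneEquiv : U ≃ₗ[k] ↥(TP k U 1) := LinearEquiv.refl k U

lemma stepEquiv_zero (c : ↥(TP k U 0)) (u : U) :
    stepEquiv k U 0 (c ⊗ₜ u) = oneEquiv (zeroEquiv c • u) := rfl

lemma concatEquiv_zero (p : ℕ) (x : ↥(TP k U p)) (c : ↥(TP k U 0)) :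
    concatEquiv k U p 0 (x ⊗ₜ c) = zeroEquiv c • x := rfl

lemma concatEquiv_one (p : ℕ) (x : ↥(TP k U p)) (u : U) :
    concatEquiv k U p 1 (x ⊗ₜ oneEquiv u) = stepEquiv k U p (x ⊗ₜ u) := rfl

lemma concatEquiv_step (p q : ℕ) (x : ↥(TP k U p)) (y : ↥(TP k U q)) (u : U) :
    concatEquiv k U p (q + 1) (x ⊗ₜ stepEquiv k U q (y ⊗ₜ u)) =
      stepEquiv k U (p + q) (concatEquiv k U p q (x ⊗ₜ y) ⊗ₜ u) := by
  cases q with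
  | zero => rw [stepEquiv_zero, concatEquiv_one, concatEquiv_zero, tmul_smul, smul_tmul']; rfl
  | succ q => rfl

/-- The embedding of the tensor power `U^{⊗n}` in the tensor algebra. -/
def toT : ∀ n : ℕ, ↥(TP k U n) →ₗ[k] TensorAlgebra k U
  | 0 => Algebra.linearMap k (TensorAlgebra k U) ∘ₗ zeroEquiv.toLinearMap
  | (n + 1) => LinearMap.mul' k _ ∘ₗ TensorProduct.map (toT n) (TensorAlgebra.ι k) ∘ₗ
      (stepEquiv k U n).symm.toLinearMap

lemma toT_zero (c : ↥(TP k U 0)) : toT 0 c = algebraMap k (TensorAlgebra k U) (zeroEquiv c) := rfl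

lemma toT_step (n : ℕ) (x : ↥(TP k U n)) (u : U) :
    toT (n + 1) (stepEquiv k U n (x ⊗ₜ u)) = toT n x * TensorAlgebra.ι k u := by
  simp [toT]

/-- Induction principle for tensor powers. -/
lemma TP_induction {motive : ∀ n, ↥(TP k U n) → Prop}
    (add : ∀ n x y, motive n x → motive n y → motive n (x + y))
    (zero : ∀ c, motive 0 c)
    (step : ∀ n x u, motive n x → motive (n + 1) (stepEquiv k U n (x ⊗ₜ u)))
    (n : ℕ) (x : ↥(TP k U n)) : motive n x := by
  induction n with
  | zero => exact zero x
  | succ n ih =>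
    obtain ⟨y, rfl⟩ := (stepEquiv k U n).surjective x
    induction y with
    | zero => 
      have := step n 0 0 (ih 0)
      simpa using this
    | tmul x u => exact step n x u (ih x)
    | add a b ha hb => rw [map_add]; exact add _ _ _ ha hb

/-- Right multiplication by an element of `U` on sequences of tensors. -/
def rightShift : U →ₗ[k] (∀ n, ↥(TP k U n)) →ₗ[k] (∀ n, ↥(TP k U n)) :=
  LinearMap.mk₂ k
    (fun u f n => match n with
      | 0 => 0
      | n + 1 => stepEquiv k U n (f n ⊗ₜ u))
    (by intro a b f; funext n; cases n <;> simp [tmul_add])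
    (by intro a b f; funext n; cases n <;> simp)
    (by intro a b f; funext n; cases n <;> simp [add_tmul])
    (by intro a b f; funext n; cases n <;> simp [← smul_tmul'])

lemma rightShift_single (n : ℕ) (x : ↥(TP k U n)) (u : U) :
    rightShift u (Pi.single n x) = Pi.single (n + 1) (stepEquiv k U n (x ⊗ₜ u)) := by
  funext m
  cases m with
  | zero => simp [rightShift]
  | succ m =>
    by_cases h : m = n
    · subst h; simp [rightShift]
    · have h' : m + 1 ≠ n + 1 := by omega
      simp [rightShift, Pi.single_eq_of_ne h, Pi.single_eq_of_ne h']

lemma toT_injective (n : ℕ) : Function.Injective (toT (k := k) (U := U) n) := by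
  let ρ : U →ₗ[k] (Module.End k (∀ n, ↥(TP k U n)))ᵐᵒᵖ :=
    (MulOpposite.opLinearEquiv k).toLinearMap ∘ₗ rightShift
  let L := TensorAlgebra.lift k ρ
  have key : ∀ n (x : ↥(TP k U n)),
      (L (toT n x)).unop (Pi.single 0 (zeroEquiv.symm 1)) = Pi.single n x := by
    intro n x
    refine TP_induction (motive := fun n x =>
      (L (toT n x)).unop (Pi.single 0 (zeroEquiv.symm 1)) = Pi.single n x) ?_ ?_ ?_ n x
    · intro n x y hx hy
      rw [map_add, map_add, MulOpposite.unop_add, LinearMap.add_apply, hx, hy, Pi.single_add]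
    · intro c
      rw [toT_zero, AlgHom.commutes, MulOpposite.algebraMap_apply, MulOpposite.unop_op,
        Module.algebraMap_end_apply, ← Pi.single_smul]
      rw [← map_smul, smul_eq_mul, mul_one, LinearEquiv.symm_apply_apply]
    · intro n x u hx
      rw [toT_step, map_mul, MulOpposite.unop_mul, Module.End.mul_apply, hx]
      simp only [L, TensorAlgebra.lift_ι_apply]
      exact rightShift_single n x u
  intro x y h
  have := key n x
  rw [h, key n y] at this
  exact (Pi.single_injective n this).symm

lemma toT_concat (p q : ℕ) (x : ↥(TP k U p)) (y : ↥(TP k U q)) :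
    toT (p + q) (concatEquiv k U p q (x ⊗ₜ y)) = toT p x * toT q y := by
  induction q with
  | zero =>
    rw [concatEquiv_zero, map_smul, Algebra.smul_def, toT_zero, Algebra.commutes]
    rfl
  | succ q ih =>
    obtain ⟨y, rfl⟩ := (stepEquiv k U q).surjective y
    induction y with
    | zero => simp
    | add a b ha hb => simp only [map_add, tmul_add, mul_add, ha, hb]
    | tmul y u => 
      rw [concatEquiv_step, toT_step, ← mul_assoc, ← ih]
      exact toT_step _ _ _

/-- The image in the tensor algebra of a subspace of `U^{⊗n}`. -/
def mapT {n : ℕ} (S : Submodule k ↥(TP k U n)) : Submodule k (TensorAlgebra k U) :=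
  S.map (toT n)

lemma mapT_injective (n : ℕ) : Function.Injective (mapT (k := k) (U := U) (n := n)) :=
  Submodule.map_injective_of_injective (toT_injective n)

lemma mapT_le_mapT {n : ℕ} {S S' : Submodule k ↥(TP k U n)} : mapT S ≤ mapT S' ↔ S ≤ S' :=
  Submodule.map_le_map_iff_of_injective (toT_injective n) _ _

lemma mapT_castTP {m n : ℕ} (h : m = n) (S : Submodule k ↥(TP k U m)) :
    mapT (castTP k U h S) = mapT S := by
  subst h; rfl

lemma range_map_subtype {M N : Type} [AddCommGroup M] [Module k M] [AddCommGroup N] [Module k N]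
    (S : Submodule k M) (S' : Submodule k N) :
    LinearMap.range (TensorProduct.map S.subtype S'.subtype) =
      Submodule.span k {z | ∃ x ∈ S, ∃ y ∈ S', x ⊗ₜ[k] y = z} := by
  rw [TensorProduct.range_map]
  simp [Submodule.map₂_eq_span_image2, Set.image2]

lemma mapT_concatSub {p q : ℕ} (S : Submodule k ↥(TP k U p)) (S' : Submodule k ↥(TP k U q)) :
    mapT (concatSub k U S S') = mapT S * mapT S' := by
  rw [mapT, concatSub, range_map_subtype, Submodule.map_span, Submodule.map_span,
    mapT, mapT, Submodule.mul_eq_span_mul_set]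
  congr 1
  ext z
  simp only [Set.mem_image, Set.mem_ofPred_eq, Set.mem_mul, SetLike.mem_coe, Submodule.mem_map]
  constructor
  · rintro ⟨_, ⟨_, ⟨x, hx, y, hy, rfl⟩, rfl⟩, rfl⟩
    exact ⟨_, ⟨x, hx, rfl⟩, _, ⟨y, hy, rfl⟩, (toT_concat p q x y).symm⟩
  · rintro ⟨_, ⟨x, hx, rfl⟩, _, ⟨y, hy, rfl⟩, rfl⟩
    exact ⟨_, ⟨_, ⟨x, hx, y, hy, rfl⟩, rfl⟩, toT_concat p q x y⟩

lemma mapT_top_zero : mapT (⊤ : Submodule k ↥(TP k U 0)) = 1 := by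
  rw [mapT, Submodule.map_top, Submodule.one_eq_range]; rfl

lemma mapT_top_mul (p q : ℕ) :
    mapT (⊤ : Submodule k ↥(TP k U p)) * mapT (⊤ : Submodule k ↥(TP k U q)) =
      mapT (⊤ : Submodule k ↥(TP k U (p + q))) := by
  rw [← mapT_concatSub]
  congr 1
  rw [concatSub, range_map_subtype, eq_top_iff]
  have : Submodule.span k {z | ∃ x ∈ (⊤ : Submodule k ↥(TP k U p)),
      ∃ y ∈ (⊤ : Submodule k ↥(TP k U q)), x ⊗ₜ[k] y = z} = ⊤ := by
    simpa using TensorProduct.span_tmul_eq_top k ↥(TP k U p) ↥(TP k U q)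
  rw [this, Submodule.map_top, LinearMap.range_eq_top.2 (concatEquiv k U p q).surjective]

lemma mapT_relTerm (R : Submodule k ↥(TP k U 2)) (i j : ℕ) :
    mapT (relTerm k U R i j) = mapT (⊤ : Submodule k ↥(TP k U i)) * mapT R *
      mapT (⊤ : Submodule k ↥(TP k U j)) := by
  rw [relTerm, mapT_castTP, mapT_concatSub, mapT_concatSub, mul_assoc]

/-- The subspace `S ⊗ U` of `U^{⊗(n+1)}`. -/
def mulU {n : ℕ} (S : Submodule k ↥(TP k U n)) : Submodule k ↥(TP k U (n + 1)) :=
  concatSub k U S (⊤ : Submodule k ↥(TP k U 1))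

lemma mulU_iSup {n : ℕ} {ι : Type} (S : ι → Submodule k ↥(TP k U n)) :
    mulU (⨆ i, S i) = ⨆ i, mulU (S i) := by
  apply mapT_injective
  have h : ∀ {n : ℕ} (S : ι → Submodule k ↥(TP k U n)), mapT (⨆ i, S i) = ⨆ i, mapT (S i) :=
    fun S => Submodule.map_iSup _ _
  simp only [h, mulU, mapT_concatSub, Submodule.iSup_mul]

/-- Over a field, membership in `S ⊗ E ⊆ M ⊗ E` is detected by the functionals on `E`. -/
lemma mem_range_rTensor_iff {M E : Type} [AddCommGroup M] [Module k M] [AddCommGroup E]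
    [Module k E] (S : Submodule k M) (x : M ⊗[k] E) :
    x ∈ LinearMap.range (S.subtype.rTensor E) ↔
      ∀ φ : E →ₗ[k] k, TensorProduct.rid k M (φ.lTensor M x) ∈ S := by
  constructor
  · rintro ⟨y, rfl⟩ φ
    induction y with
    | zero => simp
    | add a b ha hb => rw [map_add, map_add, map_add]; exact S.add_mem ha hb
    | tmul a b => simpa using S.smul_mem _ a.2
  · intro h
    let b := Module.Basis.ofVectorSpace k E
    have hx : ∀ x : M ⊗[k] E, ∃ s : Finset _, 
        x = ∑ i ∈ s, (TensorProduct.rid k M ((b.coord i).lTensor M x)) ⊗ₜ[k] b i := by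
      classical
      intro x
      have aux : ∃ s : Finset _, ∀ t, s ⊆ t → 
        x = ∑ i ∈ t, (TensorProduct.rid k M ((b.coord i).lTensor M x)) ⊗ₜ[k] b i := by
        induction x with
        | zero => exact ⟨∅, by simp⟩
        | add x y hx hy =>
          obtain ⟨s, hs⟩ := hx
          obtain ⟨t, ht⟩ := hy
          refine ⟨s ∪ t, fun r hr => ?_⟩
          simp only [map_add, add_tmul, Finset.sum_add_distrib]
          rw [← hs r (Finset.union_subset_left hr), ← ht r (Finset.union_subset_right hr)]
        | tmul m e =>
          refine ⟨(b.repr e).support, fun t ht => ?_⟩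
          simp only [LinearMap.lTensor_tmul, TensorProduct.rid_tmul, smul_tmul,
            Module.Basis.coord_apply, ← tmul_sum]
          congr 1
          conv_lhs => rw [← b.linearCombination_repr e, Finsupp.linearCombination_apply,
            Finsupp.sum_of_support_subset _ ht _ (by simp)]
      obtain ⟨s, hs⟩ := aux
      exact ⟨s, hs s subset_rfl⟩
    obtain ⟨s, hs⟩ := hx x
    rw [hs]
    exact Submodule.sum_mem _ fun i _ => ⟨⟨_, h (b.coord i)⟩ ⊗ₜ b i, by simp⟩

lemma concatSub_top_right {p q : ℕ} (S : Submodule k ↥(TP k U p)) :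
    concatSub k U S (⊤ : Submodule k ↥(TP k U q)) =
      (LinearMap.range (S.subtype.rTensor ↥(TP k U q))).map (concatEquiv k U p q).toLinearMap := by
  rw [concatSub]
  congr 1
  apply le_antisymm
  · rintro _ ⟨y, rfl⟩
    induction y with
    | zero => simp
    | add a b ha hb => rw [map_add]; exact Submodule.add_mem _ ha hb
    | tmul a b => exact ⟨a ⊗ₜ b.1, rfl⟩
  · rintro _ ⟨y, rfl⟩
    induction y with
    | zero => simp
    | add a b ha hb => rw [map_add]; exact Submodule.add_mem _ ha hb
    | tmul a b => exact ⟨a ⊗ₜ ⟨b, trivial⟩, rfl⟩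

lemma mulU_iInf {n : ℕ} {ι : Type} (S : ι → Submodule k ↥(TP k U n)) :
    mulU (⨅ i, S i) = ⨅ i, mulU (S i) := by
  ext x
  obtain ⟨x, rfl⟩ := (concatEquiv k U n 1).surjective x
  have key : ∀ S : Submodule k ↥(TP k U n), concatEquiv k U n 1 x ∈ mulU S ↔
      x ∈ LinearMap.range (S.subtype.rTensor ↥(TP k U 1)) := by
    intro S
    rw [mulU, concatSub_top_right]
    exact (concatEquiv k U n 1).injective.mem_set_image (s := SetLike.coe _)
  simp only [Submodule.mem_iInf, key, mem_range_rTensor_iff]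
  exact ⟨fun h i φ => h φ i, fun h φ i => h i φ⟩

variable (R : Submodule k ↥(TP k U 2))

lemma mulU_castTP_relTerm {i j n : ℕ} (h : i + 2 + j = n) (h' : i + 2 + (j + 1) = n + 1) :
    mulU (castTP k U h (relTerm k U R i j)) = castTP k U h' (relTerm k U R i (j + 1)) := by
  apply mapT_injective
  rw [mulU, mapT_concatSub, mapT_castTP, mapT_castTP, mapT_relTerm, mapT_relTerm, mul_assoc,
    mapT_top_mul]

lemma relTerm_zero (d : ℕ) : relTerm k U R d 0 = concatSub k U (⊤ : Submodule k ↥(TP k U d)) R := by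
  apply mapT_injective
  rw [mapT_relTerm, mapT_concatSub, mapT_top_zero, mul_one]

lemma castTP_relTerm_congr {n d i j j' : ℕ} (h : i + 2 + j = n) (h' : d + 2 + j' = n)
    (hi : i = d) (hj : j = j') :
    castTP k U h (relTerm k U R i j) = castTP k U h' (relTerm k U R d j') := by
  subst hi hj; rfl

lemma RelOf_zero : RelOf k U R 0 = ⊥ := by
  rw [RelOf]; exact iSup_of_empty (ι := Fin 0) _

lemma RelOf_one : RelOf k U R 1 = ⊥ := by
  rw [RelOf]; exact iSup_of_empty (ι := Fin 0) _

lemma Dual_zero : Dual k U R 0 = ⊤ := by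
  rw [Dual]; exact iInf_of_empty (ι := Fin 0) _

lemma Dual_one : Dual k U R 1 = ⊤ := by
  rw [Dual]; exact iInf_of_empty (ι := Fin 0) _

lemma RelOf_succ (d : ℕ) :
    RelOf k U R (d + 2) = mulU (RelOf k U R (d + 1)) ⊔ concatSub k U (p := d) (q := 2) ⊤ R := by
  conv_rhs => rw [RelOf, mulU_iSup]
  rw [RelOf]
  change ⨆ i : Fin (d + 1), _ = (⨆ i : Fin d, _) ⊔ _
  rw [show ∀ f : Fin (d + 1) → Submodule k ↥(TP k U (d + 2)),
    ⨆ i, f i = (⨆ i : Fin d, f i.castSucc) ⊔ f (Fin.last d) from fun f => by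
      apply le_antisymm
      · refine iSup_le fun i => ?_
        refine Fin.lastCases ?_ (fun i => ?_) i
        · exact le_sup_right
        · exact le_sup_of_le_left (le_iSup (fun i : Fin d => f i.castSucc) i)
      · exact sup_le (iSup_le fun i => le_iSup f _) (le_iSup f _)]
  congr 1
  · refine iSup_congr fun i => ?_
    rw [mulU_castTP_relTerm (h' := by have := i.2; omega)]
    exact castTP_relTerm_congr _ _ _ rfl (by have := i.2; simp; omega)
  · rw [castTP_relTerm_congr (h' := rfl) (d := d) (j' := 0) _ _ (by simp) (by simp)]
    exact relTerm_zero R d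

lemma Dual_succ (d : ℕ) :
    Dual k U R (d + 2) = mulU (Dual k U R (d + 1)) ⊓ concatSub k U (p := d) (q := 2) ⊤ R := by
  conv_rhs => rw [Dual, mulU_iInf]
  rw [Dual]
  change ⨅ i : Fin (d + 1), _ = (⨅ i : Fin d, _) ⊓ _
  rw [show ∀ f : Fin (d + 1) → Submodule k ↥(TP k U (d + 2)),
    ⨅ i, f i = (⨅ i : Fin d, f i.castSucc) ⊓ f (Fin.last d) from fun f => by
      apply le_antisymm
      · exact le_inf (le_iInf fun i => iInf_le f _) (iInf_le f _)
      · refine le_iInf fun i => ?_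
        refine Fin.lastCases ?_ (fun i => ?_) i
        · exact inf_le_right
        · exact inf_le_of_left_le (iInf_le (fun i : Fin d => f i.castSucc) i)]
  congr 1
  · refine iInf_congr fun i => ?_
    rw [mulU_castTP_relTerm (h' := by have := i.2; omega)]
    exact castTP_relTerm_congr _ _ _ rfl (by have := i.2; simp; omega)
  · rw [castTP_relTerm_congr (h' := rfl) (d := d) (j' := 0) _ _ (by simp) (by simp)]
    exact relTerm_zero R d

end TensorPowers

section GradedModules

variable {k : Type} [Field k] {U : Type} [AddCommGroup U] [Module k U]

/-- The action of `U ⊗ U'` obtained from two successive actions of `U` and `U'`. -/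
def act2 {U' X₀ X₁ X₂ : Type} [AddCommGroup U'] [Module k U'] [AddCommGroup X₀] [Module k X₀]
    [AddCommGroup X₁] [Module k X₁] [AddCommGroup X₂] [Module k X₂]
    (a₀ : X₀ →ₗ[k] U →ₗ[k] X₁) (a₁ : X₁ →ₗ[k] U' →ₗ[k] X₂) :
    X₀ →ₗ[k] (U ⊗[k] U') →ₗ[k] X₂ where
  toFun x := TensorProduct.lift (a₁ ∘ₗ a₀ x)
  map_add' x y := by ext; simp
  map_smul' c x := by ext; simp

@[simp] lemma act2_tmul {U' X₀ X₁ X₂ : Type} [AddCommGroup U'] [Module k U'] [AddCommGroup X₀]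
    [Module k X₀] [AddCommGroup X₁] [Module k X₁] [AddCommGroup X₂] [Module k X₂]
    (a₀ : X₀ →ₗ[k] U →ₗ[k] X₁) (a₁ : X₁ →ₗ[k] U' →ₗ[k] X₂) (x : X₀) (u : U) (u' : U') :
    act2 a₀ a₁ x (u ⊗ₜ u') = a₁ (a₀ x u) u' := rfl

lemma act2_map {U' X₀ X₁ X₂ Y₀ Y₁ Y₂ : Type} [AddCommGroup U'] [Module k U'] [AddCommGroup X₀]
    [Module k X₀] [AddCommGroup X₁] [Module k X₁] [AddCommGroup X₂] [Module k X₂]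
    [AddCommGroup Y₀] [Module k Y₀] [AddCommGroup Y₁] [Module k Y₁] [AddCommGroup Y₂] [Module k Y₂]
    (a₀ : X₀ →ₗ[k] U →ₗ[k] X₁) (a₁ : X₁ →ₗ[k] U' →ₗ[k] X₂)
    (b₀ : Y₀ →ₗ[k] U →ₗ[k] Y₁) (b₁ : Y₁ →ₗ[k] U' →ₗ[k] Y₂)
    (f₀ : X₀ → Y₀) (f₁ : X₁ → Y₁) (f₂ : X₂ →ₗ[k] Y₂)
    (h₀ : ∀ x u, f₁ (a₀ x u) = b₀ (f₀ x) u) (h₁ : ∀ x u, f₂ (a₁ x u) = b₁ (f₁ x) u)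
    (x : X₀) (r : U ⊗[k] U') : f₂ (act2 a₀ a₁ x r) = act2 b₀ b₁ (f₀ x) r := by
  induction r with
  | zero => simp
  | add r s hr hs => simp only [map_add, hr, hs]
  | tmul u u' => simp [h₀, h₁]

/-- A graded right module over the quadratic algebra `T(U)/(R)`, given by its homogeneous
components and the action of the generators. -/
structure GMod (R : Submodule k (U ⊗[k] U)) where
  /-- The homogeneous components. -/
  X : ℕ → Type
  [acg : ∀ n, AddCommGroup (X n)]
  [mod : ∀ n, Module k (X n)]
  /-- The right action of the generators. -/
  act : ∀ n, X n →ₗ[k] U →ₗ[k] X (n + 1)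
  rel : ∀ n x, ∀ r ∈ R, act2 (act n) (act (n + 1)) x r = 0

attribute [instance] GMod.acg GMod.mod

variable {R : Submodule k (U ⊗[k] U)}

/-- Morphisms of graded right modules. -/
structure GHom (M N : GMod R) where
  /-- The components of the morphism. -/
  f : ∀ n, M.X n →ₗ[k] N.X n
  comm : ∀ n x u, f (n + 1) (M.act n x u) = N.act n (f n x) u

/-- The shifted module `M(1)`. -/
def GMod.shift (M : GMod R) : GMod R where
  X n := M.X (n + 1)
  act n := M.act (n + 1)
  rel n := M.rel (n + 1)

/-- The kernel of a morphism of graded modules. -/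
def GHom.ker {M N : GMod R} (φ : GHom M N) : GMod R where
  X n := LinearMap.ker (φ.f n)
  act n := LinearMap.mk₂ k
    (fun x u => ⟨M.act n x u, by rw [LinearMap.mem_ker, φ.comm, x.2, map_zero]; rfl⟩)
    (by intros; ext; simp) (by intros; ext; simp) (by intros; ext; simp) (by intros; ext; simp)
  rel n x r hr := by
    apply Subtype.ext
    have := act2_map (LinearMap.mk₂ k
      (fun (x : LinearMap.ker (φ.f n)) u => (⟨M.act n x u, by
        rw [LinearMap.mem_ker, φ.comm, x.2, map_zero]; rfl⟩ : LinearMap.ker (φ.f (n + 1))))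
      (by intros; ext; simp) (by intros; ext; simp) (by intros; ext; simp) (by intros; ext; simp))
      (LinearMap.mk₂ k
      (fun (x : LinearMap.ker (φ.f (n + 1))) u => (⟨M.act (n + 1) x u, by
        rw [LinearMap.mem_ker, φ.comm, x.2, map_zero]; rfl⟩ : LinearMap.ker (φ.f (n + 2))))
      (by intros; ext; simp) (by intros; ext; simp) (by intros; ext; simp) (by intros; ext; simp))
      (M.act n) (M.act (n + 1)) Subtype.val Subtype.val (LinearMap.ker (φ.f (n + 2))).subtype
      (fun _ _ => rfl) (fun _ _ => rfl) x r
    exact this.trans (M.rel n x r hr)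

@[simp] lemma GHom.ker_act_val {M N : GMod R} (φ : GHom M N) (n : ℕ)
    (x : LinearMap.ker (φ.f n)) (u : U) :
    (φ.ker.act n x u : LinearMap.ker (φ.f (n + 1))).1 = M.act n x.1 u := rfl

/-- The module `E ⊗ M` for a vector space `E`. -/
def tens (E : Type) [AddCommGroup E] [Module k E] (M : GMod R) : GMod R where
  X n := E ⊗[k] M.X n
  act n := ((LinearMap.lTensorHom E) ∘ₗ (M.act n).flip).flip
  rel n x r hr := by
    induction x with
    | zero => simp
    | add x y hx hy => rw [map_add, LinearMap.add_apply, hx, hy, add_zero]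
    | tmul e m =>
      rw [← act2_map (M.act n) (M.act (n + 1)) _ _ (fun m => e ⊗ₜ m) (fun m => e ⊗ₜ m)
        (TensorProduct.mk k E _ e) (fun _ _ => rfl) (fun _ _ => rfl), M.rel n m r hr, map_zero]

@[simp] lemma tens_act (E : Type) [AddCommGroup E] [Module k E] (M : GMod R) (n : ℕ) (e : E)
    (m : M.X n) (u : U) :
    (tens E M).act n (e ⊗ₜ[k] m : E ⊗[k] M.X n) u = (e ⊗ₜ[k] M.act n m u : E ⊗[k] M.X (n + 1)) :=
  rfl

variable (R) in
/-- The weight-`n` part of the ideal generated by `R`. -/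
def Irel (n : ℕ) : Submodule k ↥(TP k U n) := RelOf k U (R.map (toTP2 k U).toLinearMap) n

lemma concat_toTP2 (n : ℕ) (x : ↥(TP k U n)) (r : U ⊗[k] U) :
    concatEquiv k U n 2 (x ⊗ₜ toTP2 k U r) =
      act2 (TensorProduct.curry (stepEquiv k U n).toLinearMap)
        (TensorProduct.curry (stepEquiv k U (n + 1)).toLinearMap) x r := by
  induction r with
  | zero => simp
  | add r s hr hs => simp only [map_add, tmul_add, hr, hs]
  | tmul u u' => rfl

lemma Irel_zero : Irel R 0 = ⊥ := RelOf_zero _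

lemma Irel_one : Irel R 1 = ⊥ := RelOf_one _

lemma mulU_le_iff {n : ℕ} (S : Submodule k ↥(TP k U n)) (S' : Submodule k ↥(TP k U (n + 1))) :
    mulU S ≤ S' ↔ ∀ x ∈ S, ∀ u, stepEquiv k U n (x ⊗ₜ u) ∈ S' := by
  rw [mulU, concatSub, range_map_subtype, Submodule.map_span, Submodule.span_le]
  constructor
  · intro h x hx u
    exact h ⟨_, ⟨x, hx, oneEquiv u, trivial, rfl⟩, rfl⟩
  · rintro h _ ⟨_, ⟨x, hx, u, -, rfl⟩, rfl⟩
    exact h x hx u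

lemma mulR_le_iff {n : ℕ} (S' : Submodule k ↥(TP k U (n + 2))) :
    concatSub k U (p := n) (q := 2) ⊤ (R.map (toTP2 k U).toLinearMap) ≤ S' ↔
      ∀ x, ∀ r ∈ R, act2 (TensorProduct.curry (stepEquiv k U n).toLinearMap)
        (TensorProduct.curry (stepEquiv k U (n + 1)).toLinearMap) x r ∈ S' := by
  rw [concatSub, range_map_subtype, Submodule.map_span, Submodule.span_le]
  constructor
  · intro h x r hr
    rw [← concat_toTP2]
    exact h ⟨_, ⟨x, trivial, toTP2 k U r, ⟨r, hr, rfl⟩, rfl⟩, rfl⟩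
  · rintro h _ ⟨_, ⟨x, -, _, ⟨r, hr, rfl⟩, rfl⟩, rfl⟩
    have := h x r hr
    rw [← concat_toTP2] at this
    exact this

lemma Irel_step {n : ℕ} {x : ↥(TP k U n)} (hx : x ∈ Irel R n) (u : U) :
    stepEquiv k U n (x ⊗ₜ u) ∈ Irel R (n + 1) := by
  cases n with
  | zero => rw [Irel_zero, Submodule.mem_bot] at hx; subst hx; simp
  | succ n =>
    have : mulU (Irel R (n + 1)) ≤ Irel R (n + 2) := by
      rw [Irel, Irel, RelOf_succ]; exact le_sup_left
    exact (mulU_le_iff _ _).1 this x hx u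

lemma Irel_act2 {n : ℕ} (x : ↥(TP k U n)) {r : U ⊗[k] U} (hr : r ∈ R) :
    act2 (TensorProduct.curry (stepEquiv k U n).toLinearMap)
        (TensorProduct.curry (stepEquiv k U (n + 1)).toLinearMap) x r ∈ Irel R (n + 2) := by
  refine (mulR_le_iff _).1 ?_ x r hr
  rw [Irel, RelOf_succ]; exact le_sup_right

lemma Irel_succ_le {n : ℕ} {S' : Submodule k ↥(TP k U (n + 2))}
    (h : ∀ x ∈ Irel R (n + 1), ∀ u, stepEquiv k U (n + 1) (x ⊗ₜ u) ∈ S')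
    (h' : ∀ x, ∀ r ∈ R, act2 (TensorProduct.curry (stepEquiv k U n).toLinearMap)
        (TensorProduct.curry (stepEquiv k U (n + 1)).toLinearMap) x r ∈ S') :
    Irel R (n + 2) ≤ S' := by
  rw [Irel, RelOf_succ]
  exact sup_le ((mulU_le_iff _ _).2 h) ((mulR_le_iff _).2 h')

variable (R) in
/-- The quadratic algebra `T(U)/(R)` as a graded right module over itself. -/
def Alg : GMod R where
  X n := ↥(TP k U n) ⧸ Irel R n
  act n := (Irel R n).liftQ
    ((LinearMap.compRight k (Irel R (n + 1)).mkQ) ∘ₗ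
      TensorProduct.curry (stepEquiv k U n).toLinearMap)
    (by
      intro x hx
      ext u
      exact (Submodule.Quotient.mk_eq_zero _).2 (Irel_step hx u))
  rel n x r hr := by
    obtain ⟨x, rfl⟩ := Submodule.Quotient.mk_surjective _ x
    rw [← act2_map (TensorProduct.curry (stepEquiv k U n).toLinearMap)
        (TensorProduct.curry (stepEquiv k U (n + 1)).toLinearMap) _ _ Submodule.Quotient.mk
        Submodule.Quotient.mk (Irel R (n + 2)).mkQ (fun _ _ => rfl) (fun _ _ => rfl)]
    exact (Submodule.Quotient.mk_eq_zero _).2 (Irel_act2 x hr)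

/-- The class in the quadratic algebra of a tensor. -/
def cls (n : ℕ) : ↥(TP k U n) →ₗ[k] (Alg R).X n := (Irel R n).mkQ

lemma cls_surjective (n : ℕ) : Function.Surjective (cls (R := R) n) := Submodule.mkQ_surjective _

lemma cls_eq_zero {n : ℕ} {x : ↥(TP k U n)} : cls (R := R) n x = 0 ↔ x ∈ Irel R n :=
  Submodule.Quotient.mk_eq_zero _

lemma ker_cls (n : ℕ) : LinearMap.ker (cls (R := R) n) = Irel R n := Submodule.ker_mkQ _

variable (R) in
/-- The unit of the quadratic algebra. -/
def aone : (Alg R).X 0 := cls 0 (zeroEquiv.symm 1)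

/-- Induction principle for the quadratic algebra. -/
lemma Alg_induction {motive : ∀ n, (Alg R).X n → Prop}
    (add : ∀ n x y, motive n x → motive n y → motive n (x + y))
    (one : ∀ c : k, motive 0 (c • aone R))
    (act : ∀ n x u, motive n x → motive (n + 1) ((Alg R).act n x u))
    (n : ℕ) (x : (Alg R).X n) : motive n x := by
  obtain ⟨x, rfl⟩ := cls_surjective n x
  refine TP_induction (motive := fun n x => motive n (cls n x)) ?_ ?_ ?_ n x
  · intro n x y hx hy; rw [map_add]; exact add _ _ _ hx hy
  · intro c
    have := one (zeroEquiv c)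
    rwa [aone, ← map_smul, ← map_smul, smul_eq_mul, mul_one, LinearEquiv.symm_apply_apply] at this
  · intro n x u hx; exact act n _ u hx

/-- The action of tensors on the component of degree zero. -/
def evT (M : GMod R) : ∀ n, ↥(TP k U n) →ₗ[k] M.X 0 →ₗ[k] M.X n
  | 0 => LinearMap.toSpanSingleton k _ LinearMap.id ∘ₗ zeroEquiv.toLinearMap
  | n + 1 => TensorProduct.lift (LinearMap.mk₂ k
      (fun t u => (M.act n).flip u ∘ₗ evT M n t)
      (by intros; ext; simp) (by intros; ext; simp) (by intros; ext; simp) (by intros; ext; simp))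
      ∘ₗ (stepEquiv k U n).symm.toLinearMap

lemma evT_zero (M : GMod R) (c : ↥(TP k U 0)) (x : M.X 0) : evT M 0 c x = zeroEquiv c • x := rfl

lemma evT_step (M : GMod R) (n : ℕ) (t : ↥(TP k U n)) (u : U) (x : M.X 0) :
    evT M (n + 1) (stepEquiv k U n (t ⊗ₜ u)) x = M.act n (evT M n t x) u := by
  simp [evT]

lemma evT_Irel (M : GMod R) (n : ℕ) (t : ↥(TP k U n)) (ht : t ∈ Irel R n) : evT M n t = 0 := by
  induction n with
  | zero => rw [Irel_zero, Submodule.mem_bot] at ht; rw [ht, map_zero]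
  | succ n ih =>
    cases n with
    | zero => rw [Irel_one, Submodule.mem_bot] at ht; rw [ht, map_zero]
    | succ n =>
      have : Irel R (n + 2) ≤ LinearMap.ker (evT M (n + 2)) := by
        refine Irel_succ_le ?_ ?_
        · intro t ht u
          rw [LinearMap.mem_ker]
          ext x
          rw [evT_step, ih t ht]; simp
        · intro t r hr
          rw [LinearMap.mem_ker]
          ext x
          have := act2_map (TensorProduct.curry (stepEquiv k U n).toLinearMap)
            (TensorProduct.curry (stepEquiv k U (n + 1)).toLinearMap) (M.act n) (M.act (n + 1))
            (fun t => evT M n t x) (fun t => evT M (n + 1) t x) ((evT M (n + 2)).flip x)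
            (fun t u => evT_step M n t u x) (fun t u => evT_step M (n + 1) t u x) t r
          exact this.trans (M.rel n _ r hr)
      exact this ht

/-- The free graded right module on a vector space. -/
abbrev Free (R : Submodule k (U ⊗[k] U)) (E : Type) [AddCommGroup E] [Module k E] : GMod R :=
  tens E (Alg R)

/-- The action of the quadratic algebra on the component of degree zero. -/
def ev (M : GMod R) (n : ℕ) : M.X 0 ⊗[k] (Alg R).X n →ₗ[k] M.X n :=
  TensorProduct.lift ((Irel R n).liftQ (evT M n) (evT_Irel M n)).flip

lemma ev_one (M : GMod R) (x : M.X 0) : ev M 0 (x ⊗ₜ aone R) = x := by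
  change evT M 0 (zeroEquiv.symm 1) x = x
  rw [evT_zero, LinearEquiv.apply_symm_apply, one_smul]

lemma ev_act (M : GMod R) (n : ℕ) (x : M.X 0) (p : (Alg R).X n) (u : U) :
    ev M (n + 1) (x ⊗ₜ (Alg R).act n p u) = M.act n (ev M n (x ⊗ₜ p)) u := by
  obtain ⟨t, rfl⟩ := cls_surjective n p
  exact evT_step M n t u x

/-- Construction of a morphism out of `E ⊗ M` from its values on pure tensors. -/
def GHom.ofTens {E : Type} [AddCommGroup E] [Module k E] {M N : GMod R}
    (f : ∀ n, E ⊗[k] M.X n →ₗ[k] N.X n)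
    (h : ∀ n e m u, f (n + 1) (e ⊗ₜ M.act n m u) = N.act n (f n (e ⊗ₜ m)) u) :
    GHom (tens E M) N where
  f := f
  comm n x u := by
    have : f (n + 1) ∘ₗ (((M.act n).flip u).lTensor E) = (N.act n).flip u ∘ₗ f n :=
      TensorProduct.ext' fun e m => h n e m u
    exact LinearMap.congr_fun this x

/-- The canonical morphism from the free module on `M₀` to `M`. -/
def evHom (M : GMod R) : GHom (Free R (M.X 0)) M :=
  GHom.ofTens (ev M) (ev_act M)

/-- Morphisms from a free module are determined in degree zero. -/
lemma Free_hom_ext {E : Type} [AddCommGroup E] [Module k E] {M : GMod R}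
    (φ ψ : GHom (Free R E) M)
    (h : ∀ e : E, φ.f 0 (e ⊗ₜ aone R : E ⊗[k] _) = ψ.f 0 (e ⊗ₜ aone R : E ⊗[k] _)) (n : ℕ) :
    φ.f n = ψ.f n := by
  apply TensorProduct.ext'
  intro e p
  refine Alg_induction (motive := fun n p =>
    φ.f n (e ⊗ₜ p : E ⊗[k] _) = ψ.f n (e ⊗ₜ p : E ⊗[k] _)) ?_ ?_ ?_ n p
  · intro n x y hx hy
    rw [tmul_add]
    exact (map_add (φ.f n) _ _).trans ((congrArg₂ _ hx hy).trans (map_add (ψ.f n) _ _).symm)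
  · intro c
    rw [tmul_smul]
    exact (map_smul (φ.f 0) _ _).trans ((congrArg _ (h e)).trans (map_smul (ψ.f 0) _ _).symm)
  · intro n p u hp
    rw [← tens_act]
    exact (φ.comm _ _ _).trans ((congrArg (fun z => M.act n z u) hp).trans (ψ.comm _ _ _).symm)

lemma Free_hom_ext_apply {E : Type} [AddCommGroup E] [Module k E] {M : GMod R}
    (φ ψ : GHom (Free R E) M)
    (h : ∀ e : E, φ.f 0 (e ⊗ₜ aone R : E ⊗[k] _) = ψ.f 0 (e ⊗ₜ aone R : E ⊗[k] _)) (n : ℕ)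
    (x : E ⊗[k] (Alg R).X n) : φ.f n x = ψ.f n x :=
  LinearMap.congr_fun (Free_hom_ext φ ψ h n) x

/-- Composition of morphisms. -/
def GHom.comp {L M N : GMod R} (ψ : GHom M N) (φ : GHom L M) : GHom L N where
  f n := ψ.f n ∘ₗ φ.f n
  comm n x u := by simp [φ.comm, ψ.comm]

/-- The morphism of free modules induced by a linear map. -/
def mapTens {E E' : Type} [AddCommGroup E] [Module k E] [AddCommGroup E'] [Module k E']
    (g : E →ₗ[k] E') (M : GMod R) : GHom (tens E M) (tens E' M) :=
  GHom.ofTens (fun n => g.rTensor (M.X n)) (fun _ _ _ _ => rfl)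

/-- The evaluation morphism is natural. -/
lemma ev_natural {M N : GMod R} (φ : GHom M N) (n : ℕ) (x : M.X 0 ⊗[k] (Alg R).X n) :
    φ.f n (ev M n x) = ev N n ((φ.f 0).rTensor _ x) :=
  Free_hom_ext_apply (φ.comp (evHom M)) ((evHom N).comp (mapTens (φ.f 0) (Alg R)))
    (fun e => (congrArg _ (ev_one M e)).trans (ev_one N (φ.f 0 e)).symm) n x

/-- The module of relations between the degree zero elements of `M`, shifted by one. -/
def Omega (M : GMod R) : GMod R := (evHom M).ker.shift

/-- `Lin t M` says that `M` is generated in degree zero and that its minimal free resolution is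
linear during the first `t` steps. -/
def Lin : ℕ → GMod R → Prop
  | 0, _ => True
  | t + 1, M => (∀ n, Function.Surjective (ev M n)) ∧ Lin t (Omega M)

/-- The morphism of relation modules induced by a morphism. -/
def omegaMap {M N : GMod R} (φ : GHom M N) : GHom (Omega M) (Omega N) where
  f n := (((φ.f 0).rTensor _).restrict (p := LinearMap.ker (ev M (n + 1)))
    (q := LinearMap.ker (ev N (n + 1))) (fun x hx => by
      rw [LinearMap.mem_ker, ← ev_natural, LinearMap.mem_ker.1 hx, map_zero]))
  comm n x u := Subtype.ext ((mapTens (φ.f 0) (Alg R)).comm (n + 1) x.1 u)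

/-- Short exact sequences of graded modules. -/
structure ShortExact {X Y Z : GMod R} (f : GHom X Y) (g : GHom Y Z) : Prop where
  inj : ∀ n, Function.Injective (f.f n)
  exact : ∀ n, Function.Exact (f.f n) (g.f n)
  surj : ∀ n, Function.Surjective (g.f n)

lemma Lin_of_subsingleton (t : ℕ) (M : GMod R) (h : ∀ n, Subsingleton (M.X n)) : Lin t M := by
  induction t generalizing M with
  | zero => trivial
  | succ t ih =>
    refine ⟨fun n y => ⟨0, Subsingleton.elim _ _⟩, ih _ fun n => ?_⟩
    have : Subsingleton (M.X 0 ⊗[k] (Alg R).X (n + 1)) := by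
      have := h 0
      infer_instance
    exact (inferInstance : Subsingleton (LinearMap.ker (ev M (n + 1))))

lemma ShortExact.omega {X Y Z : GMod R} {f : GHom X Y} {g : GHom Y Z} (h : ShortExact f g)
    (hX : ∀ n, Function.Surjective (ev X n)) :
    ShortExact (omegaMap f) (omegaMap g) where
  inj n x y hxy := by
    have := Module.Flat.rTensor_preserves_injective_linearMap (M := (Alg R).X (n + 1)) _ (h.inj 0)
    exact Subtype.ext (this (congrArg Subtype.val hxy))
  exact n := by
    have hex := rTensor_exact ((Alg R).X (n + 1)) (h.exact 0) (h.surj 0)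
    rintro ⟨y, hy⟩
    constructor
    · intro hyz
      obtain ⟨x, rfl⟩ := (hex y).1 (congrArg Subtype.val hyz)
      refine ⟨⟨x, ?_⟩, rfl⟩
      apply h.inj (n + 1)
      rw [map_zero]
      exact (ev_natural f (n + 1) x).trans hy
    · rintro ⟨x, hx⟩
      exact Subtype.ext ((hex y).2 ⟨x.1, congrArg Subtype.val hx⟩)
  surj n := by
    have hex := rTensor_exact ((Alg R).X (n + 1)) (h.exact 0) (h.surj 0)
    rintro ⟨z, hz⟩
    obtain ⟨y, hy⟩ := LinearMap.rTensor_surjective ((Alg R).X (n + 1)) (h.surj 0) z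
    obtain ⟨x, hx⟩ := (h.exact (n + 1) (ev Y (n + 1) y)).1 (by
      rw [ev_natural, hy]; exact hz)
    obtain ⟨x, rfl⟩ := hX _ x
    refine ⟨⟨y - (f.f 0).rTensor _ x, ?_⟩, Subtype.ext ?_⟩
    · change ev Y (n + 1) _ = 0
      rw [map_sub, ← ev_natural, hx, sub_self]
    · change (g.f 0).rTensor _ (y - (f.f 0).rTensor _ x) = z
      rw [map_sub, hy, (hex _).2 ⟨x, rfl⟩]
      exact sub_zero _

lemma ShortExact.ev_surjective {X Y Z : GMod R} {f : GHom X Y} {g : GHom Y Z}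
    (h : ShortExact f g) (hX : ∀ n, Function.Surjective (ev X n))
    (hZ : ∀ n, Function.Surjective (ev Z n)) (n : ℕ) : Function.Surjective (ev Y n) := by
  intro y
  obtain ⟨z, hz⟩ := hZ n (g.f n y)
  obtain ⟨y', rfl⟩ := LinearMap.rTensor_surjective ((Alg R).X n) (h.surj 0) z
  obtain ⟨x, hx⟩ := (h.exact n (y - ev Y n y')).1 (by rw [map_sub, ev_natural, hz, sub_self])
  obtain ⟨x, rfl⟩ := hX n x
  exact ⟨y' + (f.f 0).rTensor _ x, by rw [map_add, ← ev_natural, hx, add_sub_cancel]⟩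

/-- Extensions of linear modules are linear. -/
lemma ShortExact.lin {X Y Z : GMod R} {f : GHom X Y} {g : GHom Y Z} (h : ShortExact f g) {t : ℕ}
    (hX : Lin t X) (hZ : Lin t Z) : Lin t Y := by
  induction t generalizing X Y Z with
  | zero => trivial
  | succ t ih => exact ⟨h.ev_surjective hX.1 hZ.1, ih (h.omega hX.1) hX.2 hZ.2⟩

variable (R) in
/-- The zero module. -/
def zeroMod : GMod R where
  X _ := PUnit
  act _ := 0
  rel _ _ _ _ := rfl

lemma Lin_zeroMod (t : ℕ) : Lin t (zeroMod R) :=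
  Lin_of_subsingleton t _ fun _ => (inferInstance : Subsingleton PUnit)

lemma Lin_of_bijective {M N : GMod R} (φ : GHom M N) (h : ∀ n, Function.Bijective (φ.f n)) {t : ℕ} :
    Lin t M ↔ Lin t N := by
  constructor
  · intro hM
    let z : GHom N (zeroMod R) := ⟨fun _ => 0, fun _ _ _ => rfl⟩
    refine ShortExact.lin (f := φ) (g := z) ⟨fun n => (h n).1, fun n y => ?_, fun n y => ⟨0, rfl⟩⟩
      hM (Lin_zeroMod t)
    exact ⟨fun _ => (h n).2 y, fun _ => rfl⟩
  · intro hN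
    let z : GHom (zeroMod R) M := ⟨fun _ => 0, fun _ _ _ => by simp⟩
    refine ShortExact.lin (f := z) (g := φ) ⟨fun n _ _ _ => rfl, fun n y => ?_, fun n => (h n).2⟩
      (Lin_zeroMod t) hN
    constructor
    · intro hy
      exact ⟨PUnit.unit, ((h n).1 (hy.trans (map_zero _).symm)).symm⟩
    · rintro ⟨x, rfl⟩
      exact map_zero _

/-- A presentation `0 → N → M(1) → M'(1) → 0` with `M₀ = M'₀`. -/
structure Presentation {N M M' : GMod R} (ι : ∀ n, N.X n →ₗ[k] M.X (n + 1)) (g : GHom M M') :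
    Prop where
  comm : ∀ n x u, ι (n + 1) (N.act n x u) = M.act (n + 1) (ι n x) u
  inj : ∀ n, Function.Injective (ι n)
  exact : ∀ n, Function.Exact (ι n) (g.f (n + 1))
  surj : ∀ n, Function.Surjective (g.f n)
  inj_zero : Function.Injective (g.f 0)

lemma Presentation.exists_omega {N M M' : GMod R} {ι : ∀ n, N.X n →ₗ[k] M.X (n + 1)}
    {g : GHom M M'} (h : Presentation ι g) (hM : ∀ n, Function.Surjective (ev M n)) :
    ∃ ψ : GHom (Omega M') N, ShortExact (omegaMap g) ψ := by
  let e : M.X 0 ≃ₗ[k] M'.X 0 := LinearEquiv.ofBijective (g.f 0) ⟨h.inj_zero, h.surj 0⟩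
  let E : ∀ n, M.X 0 ⊗[k] (Alg R).X n ≃ₗ[k] M'.X 0 ⊗[k] (Alg R).X n := fun n =>
    TensorProduct.congr e (LinearEquiv.refl k _)
  have hE : ∀ n x, E n x = (g.f 0).rTensor _ x := fun n x => rfl
  have hEe : ∀ n x, ev M' n (E n x) = g.f n (ev M n x) := fun n x => (ev_natural g n x).symm
  have hker : ∀ n, ∀ x : LinearMap.ker (ev M' (n + 1)),
      ∃ y, ι n y = ev M (n + 1) ((E (n + 1)).symm x.1) := by
    intro n x
    refine (h.exact n _).1 ?_
    rw [← hEe, LinearEquiv.apply_symm_apply]; exact x.2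
  choose F hF using hker
  refine ⟨⟨fun n => ⟨⟨F n, fun x y => ?_⟩, fun c x => ?_⟩, fun n x u => ?_⟩, ⟨?_, ?_, ?_⟩⟩
  · apply h.inj
    refine (hF n _).trans (Eq.trans ?_ ((congrArg₂ _ (hF n x) (hF n y)).symm.trans
      (map_add (ι n) _ _).symm))
    exact map_add (ev M (n + 1) ∘ₗ (E (n + 1)).symm.toLinearMap) x.1 y.1
  · apply h.inj
    refine (hF n _).trans (Eq.trans ?_ ((congrArg (c • ·) (hF n x)).symm.trans
      (map_smul (ι n) _ _).symm))
    exact map_smul (ev M (n + 1) ∘ₗ (E (n + 1)).symm.toLinearMap) c x.1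
  · apply h.inj
    refine (hF _ _).trans ?_
    rw [h.comm]
    refine Eq.trans ?_ (congrArg (fun z => M.act (n + 1) z u) (hF n x).symm)
    have h1 := (mapTens e.symm.toLinearMap (Alg R)).comm (n + 1) x.1 u
    have h2 := (evHom M).comm (n + 1) ((E (n + 1)).symm x.1) u
    exact (congrArg (ev M (n + 2)) h1).trans h2
  · intro n x y hxy
    exact Subtype.ext ((E (n + 1)).injective (congrArg Subtype.val hxy))
  · intro n y
    constructor
    · intro hy
      refine ⟨⟨(E (n + 1)).symm y.1, ?_⟩, Subtype.ext ((E (n + 1)).apply_symm_apply y.1)⟩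
      change ev M (n + 1) _ = 0
      rw [← hF n y]
      exact (congrArg _ hy).trans (map_zero _)
    · rintro ⟨x, rfl⟩
      apply h.inj
      refine (hF n _).trans ?_
      rw [map_zero]
      exact (congrArg _ ((E (n + 1)).symm_apply_apply x.1)).trans x.2
  · intro n y
    obtain ⟨x, hx⟩ := hM (n + 1) (ι n y)
    refine ⟨⟨E (n + 1) x, ?_⟩, ?_⟩
    · change ev M' (n + 1) _ = 0
      rw [hEe, hx]; exact (h.exact n _).2 ⟨y, rfl⟩
    · apply h.inj
      refine (hF n _).trans ?_
      rw [LinearEquiv.symm_apply_apply, hx]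

lemma Presentation.lin {N M M' : GMod R} {ι : ∀ n, N.X n →ₗ[k] M.X (n + 1)}
    {g : GHom M M'} (h : Presentation ι g) {t : ℕ} (hM : Lin (t + 1) M) (hN : Lin t N) :
    Lin (t + 1) M' := by
  obtain ⟨ψ, hψ⟩ := h.exists_omega hM.1
  refine ⟨fun n y => ?_, hψ.lin hM.2 hN⟩
  obtain ⟨x, rfl⟩ := h.surj n y
  obtain ⟨x, rfl⟩ := hM.1 n x
  exact ⟨_, (ev_natural g n x).symm⟩

/-- A module on which evaluation is bijective is linear. -/
lemma Lin_of_ev_bijective (M : GMod R) (h : ∀ n, Function.Bijective (ev M n)) (t : ℕ) :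
    Lin t M := by
  cases t with
  | zero => trivial
  | succ t =>
    refine ⟨fun n => (h n).2, Lin_of_subsingleton _ _ fun n => ?_⟩
    refine ⟨fun x y => Subtype.ext ((h (n + 1)).1 ?_)⟩
    exact x.2.trans y.2.symm

/-- The syzygy of a linear module with respect to a free cover is linear. -/
lemma Presentation.lin_of_free {N M M' : GMod R} {ι : ∀ n, N.X n →ₗ[k] M.X (n + 1)}
    {g : GHom M M'} (h : Presentation ι g) (hM : ∀ n, Function.Bijective (ev M n)) {t : ℕ}
    (hM' : Lin (t + 1) M') : Lin t N := by
  obtain ⟨ψ, hψ⟩ := h.exists_omega fun n => (hM n).2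
  have hs : ∀ n, Subsingleton ((Omega M).X n) := fun n =>
    ⟨fun x y => Subtype.ext ((hM (n + 1)).1 (x.2.trans y.2.symm))⟩
  refine (Lin_of_bijective ψ fun n => ⟨?_, hψ.surj n⟩).1 hM'.2
  rw [injective_iff_map_eq_zero]
  intro y hy
  obtain ⟨x, rfl⟩ := (hψ.exact n y).1 hy
  rw [@Subsingleton.elim _ (hs n) x 0, map_zero]

instance trivAddCommGroup (E : Type) [AddCommGroup E] (n : ℕ) :
    AddCommGroup (Nat.rec (motive := fun _ => Type) E (fun _ _ => PUnit) n) :=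
  match n with
  | 0 => inferInstanceAs (AddCommGroup E)
  | _ + 1 => inferInstanceAs (AddCommGroup PUnit)

instance trivModule (E : Type) [AddCommGroup E] [Module k E] (n : ℕ) :
    Module k (Nat.rec (motive := fun _ => Type) E (fun _ _ => PUnit) n) :=
  match n with
  | 0 => inferInstanceAs (Module k E)
  | _ + 1 => inferInstanceAs (Module k PUnit)

variable (R) in
/-- A vector space as a graded module concentrated in degree zero. -/
def trivMod (E : Type) [AddCommGroup E] [Module k E] : GMod R where
  X n := Nat.rec (motive := fun _ => Type) E (fun _ _ => PUnit) n
  act _ := 0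
  rel _ _ _ _ := (Subsingleton.elim (α := PUnit) _ _)

lemma trivMod_subsingleton (E : Type) [AddCommGroup E] [Module k E] (n : ℕ) :
    Subsingleton ((trivMod R E).X (n + 1)) :=
  inferInstanceAs (Subsingleton PUnit)

/-- The degree zero part of a free module. -/
lemma tmul_aone_bijective (E : Type) [AddCommGroup E] [Module k E] :
    Function.Bijective (fun e : E => e ⊗ₜ[k] aone R) := by
  constructor
  · intro x y hxy
    exact (ev_one (trivMod R E) x).symm.trans ((congrArg (ev (trivMod R E) 0) hxy).trans
      (ev_one (trivMod R E) y))
  · intro x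
    induction x with
    | zero => exact ⟨0, zero_tmul _ _⟩
    | add x y hx hy =>
      obtain ⟨a, rfl⟩ := hx
      obtain ⟨b, rfl⟩ := hy
      exact ⟨a + b, add_tmul _ _ _⟩
    | tmul e p =>
      obtain ⟨t, rfl⟩ := cls_surjective 0 p
      refine ⟨zeroEquiv t • e, ?_⟩
      change (zeroEquiv t • e) ⊗ₜ[k] cls 0 (zeroEquiv.symm 1) = _
      rw [smul_tmul, ← map_smul, ← map_smul, smul_eq_mul, mul_one, LinearEquiv.symm_apply_apply]

lemma ev_Free_bijective (E : Type) [AddCommGroup E] [Module k E] (n : ℕ) :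
    Function.Bijective (ev (Free R E) n) := by
  let i : E →ₗ[k] E ⊗[k] (Alg R).X 0 := (TensorProduct.mk k E _).flip (aone R)
  have hi : Function.Surjective i := (tmul_aone_bijective E).2
  have key : ∀ x : E ⊗[k] (Alg R).X n, ev (Free R E) n (i.rTensor _ x) = x := fun x =>
    Free_hom_ext_apply ((evHom (Free R E)).comp (mapTens i (Alg R))) ⟨fun _ => LinearMap.id,
      fun _ _ _ => rfl⟩ (fun e => ev_one (Free R E) (i e)) n x
  refine ⟨fun x y hxy => ?_, fun x => ⟨_, key x⟩⟩
  obtain ⟨x, rfl⟩ := LinearMap.rTensor_surjective _ hi x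
  obtain ⟨y, rfl⟩ := LinearMap.rTensor_surjective _ hi y
  exact congrArg _ ((key x).symm.trans (hxy.trans (key y)))

lemma Lin_Free (E : Type) [AddCommGroup E] [Module k E] (t : ℕ) : Lin t (Free R E) :=
  Lin_of_ev_bijective _ (ev_Free_bijective E) t

/-- A linear complex of graded modules `⋯ → C₁(-1) → C₀ → M → 0`, exact everywhere. -/
structure Resolution (C : ℕ → GMod R) (d : ∀ j n, (C (j + 1)).X n →ₗ[k] (C j).X (n + 1))
    {M : GMod R} (ε : GHom (C 0) M) : Prop where
  comm : ∀ j n x u, d j (n + 1) ((C (j + 1)).act n x u) = (C j).act (n + 1) (d j n x) u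
  surj : ∀ n, Function.Surjective (ε.f n)
  inj_zero : Function.Injective (ε.f 0)
  exact_zero : ∀ n, Function.Exact (d 0 n) (ε.f (n + 1))
  inj_succ : ∀ j, Function.Injective (d j 0)
  exact_succ : ∀ j n, Function.Exact (d (j + 1) n) (d j (n + 1))

lemma Resolution.lin {C : ℕ → GMod R} {d : ∀ j n, (C (j + 1)).X n →ₗ[k] (C j).X (n + 1)}
    {M : GMod R} {ε : GHom (C 0) M} (h : Resolution C d ε) (hC : ∀ j t, Lin t (C j)) (t : ℕ) :
    Lin t M := by
  induction t generalizing C M with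
  | zero => trivial
  | succ t ih =>
    let ε' : GHom (C 1) ε.ker.shift :=
      ⟨fun n => (d 0 n).codRestrict (LinearMap.ker (ε.f (n + 1)))
        fun x => (h.exact_zero n _).2 ⟨x, rfl⟩, fun n x u => Subtype.ext (h.comm 0 n x u)⟩
    have hε' : Resolution (fun j => C (j + 1)) (fun j => d (j + 1)) ε' := by
      refine ⟨fun j => h.comm (j + 1), fun n y => ?_, fun x y hxy => ?_, fun n y => ?_,
        fun j => h.inj_succ (j + 1), fun j => h.exact_succ (j + 1)⟩
      · obtain ⟨x, hx⟩ := (h.exact_zero n y.1).1 y.2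
        exact ⟨x, Subtype.ext hx⟩
      · exact h.inj_succ 0 (congrArg Subtype.val hxy)
      · exact ⟨fun hy => (h.exact_succ 0 n y).1 (congrArg Subtype.val hy),
          fun hy => Subtype.ext ((h.exact_succ 0 n y).2 hy)⟩
    have hN := ih hε' fun j => hC (j + 1)
    refine Presentation.lin (ι := fun n => (LinearMap.ker (ε.f (n + 1))).subtype) (g := ε)
      ⟨fun _ _ _ => rfl, fun n => Subtype.val_injective, fun n y => ?_, h.surj, h.inj_zero⟩
      (hC 0 (t + 1)) hN
    exact ⟨fun hy => ⟨⟨y, hy⟩, rfl⟩, by rintro ⟨x, rfl⟩; exact x.2⟩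

lemma assoc_symm_tmul_eq {E N P : Type} [AddCommGroup E] [Module k E] [AddCommGroup N] [Module k N]
    [AddCommGroup P] [Module k P] (e : E) (x : N ⊗[k] P) :
    (TensorProduct.assoc k E N P).symm (e ⊗ₜ x) = (TensorProduct.mk k E N e).rTensor P x := by
  have : (TensorProduct.assoc k E N P).symm.toLinearMap ∘ₗ TensorProduct.mk k E (N ⊗[k] P) e =
      (TensorProduct.mk k E N e).rTensor P := TensorProduct.ext' fun _ _ => rfl
  exact LinearMap.congr_fun this x

/-- Tensoring with a vector space preserves linearity. -/
lemma Lin.tens {M : GMod R} {t : ℕ} (h : Lin t M) (E : Type) [AddCommGroup E] [Module k E] :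
    Lin t (tens E M) := by
  induction t generalizing M with
  | zero => trivial
  | succ t ih =>
    have key : ∀ n (x : E ⊗[k] (M.X 0 ⊗[k] (Alg R).X n)),
        ev (QuadraticKoszul.tens E M) n ((TensorProduct.assoc k E (M.X 0) ((Alg R).X n)).symm x) =
          (ev M n).lTensor E x := by
      intro n x
      induction x with
      | zero => exact ((congrArg _ (map_zero _)).trans (map_zero _)).trans (map_zero _).symm
      | add x y hx hy =>
        rw [map_add ((TensorProduct.assoc k E (M.X 0) ((Alg R).X n)).symm), map_add ((ev M n).lTensor E)]
        exact (map_add (ev (QuadraticKoszul.tens E M) n) _ _).trans (congrArg₂ _ hx hy)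
      | tmul e x =>
        rw [assoc_symm_tmul_eq]
        exact Free_hom_ext_apply ((evHom (QuadraticKoszul.tens E M)).comp
          (mapTens (TensorProduct.mk k E (M.X 0) e) (Alg R)))
          (GHom.comp (L := Free R (M.X 0)) (N := QuadraticKoszul.tens E M)
            ⟨fun n => TensorProduct.mk k E (M.X n) e, fun _ _ _ => rfl⟩ (evHom M))
          (fun m => (ev_one (QuadraticKoszul.tens E M) (e ⊗ₜ[k] m : E ⊗[k] M.X 0)).trans
            (congrArg (fun z => (e ⊗ₜ[k] z : E ⊗[k] M.X 0)) (ev_one M m).symm)) n x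
    refine ⟨fun n => ?_, ?_⟩
    · intro y
      obtain ⟨x, rfl⟩ := LinearMap.lTensor_surjective E (h.1 n) y
      exact ⟨_, key n x⟩
    · have hex : ∀ n, Function.Exact ((LinearMap.ker (ev M (n + 1))).subtype.lTensor E)
          ((ev M (n + 1)).lTensor E) := fun n =>
        Module.Flat.lTensor_exact E (LinearMap.exact_subtype_ker_map _)
      let φ : GHom (QuadraticKoszul.tens E (Omega M)) (Omega (QuadraticKoszul.tens E M)) :=
        GHom.ofTens (fun n => ((TensorProduct.assoc k E (M.X 0) ((Alg R).X (n + 1))).symm.toLinearMap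
          ∘ₗ (LinearMap.ker (ev M (n + 1))).subtype.lTensor E).codRestrict
          (LinearMap.ker (ev (QuadraticKoszul.tens E M) (n + 1))) fun x => by
            rw [LinearMap.mem_ker]
            exact (key (n + 1) _).trans ((hex n _).2 ⟨x, rfl⟩)) (by
          intro n e m u
          apply Subtype.ext
          obtain ⟨m, hm⟩ := m
          change (TensorProduct.assoc k E (M.X 0) ((Alg R).X (n + 2))).symm
            (e ⊗ₜ ((Free R (M.X 0)).act (n + 1) m u)) =
            (Free R (E ⊗[k] M.X 0)).act (n + 1)
              ((TensorProduct.assoc k E (M.X 0) ((Alg R).X (n + 1))).symm (e ⊗ₜ m)) u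
          exact (assoc_symm_tmul_eq e _).trans
            (((mapTens (TensorProduct.mk k E (M.X 0) e) (Alg R)).comm (n + 1) m u).trans
            (congrArg (fun z => (Free R (E ⊗[k] M.X 0)).act (n + 1) z u)
              (assoc_symm_tmul_eq e m).symm)))
      refine (Lin_of_bijective φ fun n => ⟨fun x y hxy => ?_, fun y => ?_⟩).1 (ih h.2)
      · exact Module.Flat.lTensor_preserves_injective_linearMap
          (LinearMap.ker (ev M (n + 1))).subtype Subtype.val_injective
          ((TensorProduct.assoc k E (M.X 0) ((Alg R).X (n + 1))).symm.injective
            (congrArg Subtype.val hxy))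
      · obtain ⟨y, hy⟩ := y
        obtain ⟨z, rfl⟩ := (TensorProduct.assoc k E (M.X 0) ((Alg R).X (n + 1))).symm.surjective y
        obtain ⟨x, rfl⟩ := (hex n z).1 ((key (n + 1) z).symm.trans hy)
        exact ⟨x, Subtype.ext rfl⟩

end GradedModules

section KoszulComplex

variable {k : Type} [Field k] {U : Type} [AddCommGroup U] [Module k U]
variable {R : Submodule k (U ⊗[k] U)}

/-- The morphism out of a free module extending a linear map on generators. -/
def freeHom {E : Type} [AddCommGroup E] [Module k E] (M : GMod R) (g : E →ₗ[k] M.X 0) :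
    GHom (Free R E) M :=
  (evHom M).comp (mapTens g (Alg R))

lemma freeHom_one {E : Type} [AddCommGroup E] [Module k E] (M : GMod R) (g : E →ₗ[k] M.X 0)
    (e : E) : (freeHom M g).f 0 (e ⊗ₜ aone R : E ⊗[k] _) = g e :=
  ev_one M (g e)

variable (R) in
/-- The components of the Koszul dual. -/
abbrev Kd (d : ℕ) : Submodule k ↥(TP k U d) := Dual k U (R.map (toTP2 k U).toLinearMap) d

lemma Kd_succ_le (d : ℕ) : Kd R (d + 1) ≤ mulU (Kd R d) := by
  cases d with
  | zero =>
    rw [← mapT_le_mapT, mulU, mapT_concatSub, Kd, Kd, Dual_zero, Dual_one, mapT_top_mul]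
  | succ d => rw [Kd, Dual_succ]; exact inf_le_left

variable (R) in
/-- The multiplication `Kd d ⊗ U^{⊗m} → T(U)`. -/
def cT (d m : ℕ) : ↥(Kd R d) ⊗[k] ↥(TP k U m) →ₗ[k] TensorAlgebra k U :=
  toT (d + m) ∘ₗ (concatEquiv k U d m).toLinearMap ∘ₗ (Kd R d).subtype.rTensor _

lemma cT_tmul (d m : ℕ) (x : Kd R d) (y : ↥(TP k U m)) :
    cT R d m (x ⊗ₜ y) = toT d x.1 * toT m y := toT_concat d m x.1 y

lemma cT_injective (d m : ℕ) : Function.Injective (cT R d m) :=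
  (toT_injective _).comp ((concatEquiv k U d m).injective.comp
    (Module.Flat.rTensor_preserves_injective_linearMap _ Subtype.val_injective))

lemma map_cT (d m : ℕ) (S : Submodule k ↥(TP k U m)) :
    (LinearMap.range (S.subtype.lTensor (Kd R d))).map (cT R d m) = mapT (Kd R d) * mapT S := by
  rw [← mapT_concatSub, concatSub, mapT, ← Submodule.map_comp, cT, ← LinearMap.comp_assoc,
    Submodule.map_comp]
  congr 1
  rw [← LinearMap.range_comp, LinearMap.rTensor_comp_lTensor]

lemma range_cT (d m : ℕ) :
    LinearMap.range (cT R d m) = mapT (Kd R d) * mapT (⊤ : Submodule k ↥(TP k U m)) := by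
  rw [← map_cT, ← Submodule.map_top]
  congr 1
  refine (LinearMap.range_eq_top.2 (LinearMap.lTensor_surjective _ fun y => ?_)).symm
  exact ⟨⟨y, trivial⟩, rfl⟩

lemma cT_mem_iff (d m : ℕ) (S : Submodule k ↥(TP k U m)) (z : ↥(Kd R d) ⊗[k] ↥(TP k U m)) :
    cT R d m z ∈ mapT (Kd R d) * mapT S ↔ z ∈ LinearMap.range (S.subtype.lTensor (Kd R d)) := by
  rw [← map_cT]
  exact (cT_injective (R := R) d m).mem_set_image

variable (R) in
/-- The projection `Kd d ⊗ U^{⊗m} → Kd d ⊗ A_m`. -/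
def clsT (d m : ℕ) : ↥(Kd R d) ⊗[k] ↥(TP k U m) →ₗ[k] ↥(Kd R d) ⊗[k] (Alg R).X m :=
  (cls m).lTensor (Kd R d)

lemma clsT_surjective (d m : ℕ) : Function.Surjective (clsT R d m) :=
  LinearMap.lTensor_surjective _ (cls_surjective m)

lemma clsT_eq_zero {d m : ℕ} {z : ↥(Kd R d) ⊗[k] ↥(TP k U m)} :
    clsT R d m z = 0 ↔ cT R d m z ∈ mapT (Kd R d) * mapT (Irel R m) := by
  rw [cT_mem_iff]
  have hex : Function.Exact ((Irel R m).subtype) (cls (R := R) m) := by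
    rw [LinearMap.exact_iff, ker_cls, Submodule.range_subtype]
  exact (lTensor_exact (Kd R d) hex (cls_surjective m)) z

variable (R) in
/-- The multiplication `Kd d ⊗ U → U^{⊗(d+1)}`. -/
def stepKd (d : ℕ) : ↥(Kd R d) ⊗[k] U →ₗ[k] ↥(TP k U (d + 1)) :=
  (stepEquiv k U d).toLinearMap ∘ₗ (Kd R d).subtype.rTensor U

lemma stepKd_injective (d : ℕ) : Function.Injective (stepKd R d) :=
  (stepEquiv k U d).injective.comp
    (Module.Flat.rTensor_preserves_injective_linearMap _ Subtype.val_injective)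

lemma range_stepKd (d : ℕ) : LinearMap.range (stepKd R d) = mulU (Kd R d) := by
  rw [mulU, concatSub_top_right, stepKd, LinearMap.range_comp]
  rfl

variable (R) in
/-- The inclusion `Kd (d + 1) ⊆ Kd d ⊗ U`. -/
def splitKd (d : ℕ) : ↥(Kd R (d + 1)) →ₗ[k] ↥(Kd R d) ⊗[k] U :=
  (LinearEquiv.ofInjective (stepKd R d) (stepKd_injective d)).symm.toLinearMap ∘ₗ
    Submodule.inclusion ((Kd_succ_le d).trans (range_stepKd d).ge)

lemma stepKd_splitKd (d : ℕ) (x : Kd R (d + 1)) : stepKd R d (splitKd R d x) = x.1 :=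
  congrArg Subtype.val ((LinearEquiv.ofInjective (stepKd R d) (stepKd_injective d)).apply_symm_apply
    (Submodule.inclusion ((Kd_succ_le d).trans (range_stepKd d).ge) x))

variable (R) in
/-- The Koszul differential, as a morphism of free modules. -/
def kdiff (d : ℕ) : GHom (Free R (Kd R (d + 1))) (Free R (Kd R d)).shift :=
  freeHom _ ((cls 1 ∘ₗ oneEquiv.toLinearMap).lTensor (Kd R d) ∘ₗ splitKd R d)

lemma cT_lTensor_step (d m : ℕ) (u : U) (z : ↥(Kd R d) ⊗[k] ↥(TP k U m)) :
    cT R d (m + 1) (((TensorProduct.curry (stepEquiv k U m).toLinearMap).flip u).lTensor _ z) =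
      cT R d m z * TensorAlgebra.ι k u := by
  induction z with
  | zero => simp
  | add x y hx hy => simp only [map_add, hx, hy, add_mul]
  | tmul x y =>
    rw [LinearMap.lTensor_tmul, cT_tmul, cT_tmul, mul_assoc, ← toT_step]; rfl

lemma cT_lTensor_one (d : ℕ) (z : ↥(Kd R d) ⊗[k] U) :
    cT R d 1 (oneEquiv.toLinearMap.lTensor _ z) = toT (d + 1) (stepKd R d z) := by
  induction z with
  | zero => simp
  | add x y hx hy => simp only [map_add, hx, hy]
  | tmul x y => rfl

lemma exists_kdiff_tmul (d m : ℕ) (x : Kd R (d + 1)) (t : ↥(TP k U m)) :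
    ∃ z, cT R d (m + 1) z = toT (d + 1) x.1 * toT m t ∧
      (kdiff R d).f m (x ⊗ₜ[k] cls m t : ↥(Kd R (d + 1)) ⊗[k] _) = clsT R d (m + 1) z := by
  refine TP_induction (motive := fun m t => ∃ z, cT R d (m + 1) z = toT (d + 1) x.1 * toT m t ∧
      (kdiff R d).f m (x ⊗ₜ[k] cls m t : ↥(Kd R (d + 1)) ⊗[k] _) = clsT R d (m + 1) z)
      ?_ ?_ ?_ m t
  · rintro m t t' ⟨z, hz, hz'⟩ ⟨w, hw, hw'⟩
    refine ⟨z + w, by rw [map_add, hz, hw, map_add, mul_add], ?_⟩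
    rw [map_add (cls m), tmul_add, map_add (clsT R d (m + 1))]
    exact (map_add ((kdiff R d).f m) _ _).trans (congrArg₂ _ hz' hw')
  · intro c
    have hc : cls 0 c = zeroEquiv c • aone R := by
      rw [aone, ← map_smul, ← map_smul, smul_eq_mul, mul_one, LinearEquiv.symm_apply_apply]
    refine ⟨zeroEquiv c • oneEquiv.toLinearMap.lTensor _ (splitKd R d x), ?_, ?_⟩
    · rw [map_smul, cT_lTensor_one, stepKd_splitKd, toT_zero, Algebra.smul_def, Algebra.commutes]
    · rw [hc, tmul_smul, map_smul (clsT R d (0 + 1))]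
      refine (map_smul ((kdiff R d).f 0) _ _).trans (congrArg (zeroEquiv c • ·) ?_)
      refine (freeHom_one _ _ x).trans ?_
      exact (LinearMap.lTensor_comp_apply _ _ _ _)
  · rintro m t u ⟨z, hz, hz'⟩
    refine ⟨_, (cT_lTensor_step d (m + 1) u z).trans ?_, ?_⟩
    · rw [hz, mul_assoc, toT_step]
    · refine ((kdiff R d).comm m (x ⊗ₜ[k] cls m t : ↥(Kd R (d + 1)) ⊗[k] _) u).trans ?_
      refine (congrArg (fun z => (Free R (Kd R d)).act (m + 1) z u) hz').trans ?_
      have h : ((Free R (Kd R d)).act (m + 1)).flip u ∘ₗ clsT R d (m + 1) = clsT R d (m + 1 + 1) ∘ₗ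
        ((TensorProduct.curry (stepEquiv k U (m + 1)).toLinearMap).flip u).lTensor _ :=
        TensorProduct.ext' fun _ _ => rfl
      exact LinearMap.congr_fun h z

lemma exists_kdiff (d m : ℕ) (y : ↥(Kd R (d + 1)) ⊗[k] ↥(TP k U m)) :
    ∃ z, cT R d (m + 1) z = cT R (d + 1) m y ∧
      (kdiff R d).f m (clsT R (d + 1) m y) = clsT R d (m + 1) z := by
  induction y with
  | zero => exact ⟨0, by simp, by rw [map_zero, map_zero]; exact map_zero _⟩
  | add x y hx hy =>
    obtain ⟨z, hz, hz'⟩ := hx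
    obtain ⟨w, hw, hw'⟩ := hy
    refine ⟨z + w, by rw [map_add, hz, hw, map_add], ?_⟩
    rw [map_add (clsT R (d + 1) m), map_add (clsT R d (m + 1))]
    exact (map_add ((kdiff R d).f m) _ _).trans (congrArg₂ _ hz' hw')
  | tmul x t =>
    rw [cT_tmul]
    exact exists_kdiff_tmul d m x t

lemma kdiff_eq_zero {d m : ℕ} {y : ↥(Kd R (d + 1)) ⊗[k] ↥(TP k U m)} :
    (kdiff R d).f m (clsT R (d + 1) m y) = 0 ↔
      cT R (d + 1) m y ∈ mapT (Kd R d) * mapT (Irel R (m + 1)) := by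
  obtain ⟨z, hz, hz'⟩ := exists_kdiff d m y
  rw [← hz, ← clsT_eq_zero, ← hz']
  rfl

lemma kdiff_mem_range {d m : ℕ} {y : ↥(Kd R d) ⊗[k] ↥(TP k U (m + 1))} :
    clsT R d (m + 1) y ∈ Set.range ((kdiff R d).f m) ↔
      cT R d (m + 1) y ∈ mapT (Kd R d) * mapT (Irel R (m + 1)) ⊔
        mapT (Kd R (d + 1)) * mapT (⊤ : Submodule k ↥(TP k U m)) := by
  rw [Submodule.mem_sup, ← range_cT]
  constructor
  · rintro ⟨x, hx⟩
    obtain ⟨x, rfl⟩ := clsT_surjective (d + 1) m x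
    obtain ⟨z, hz, hz'⟩ := exists_kdiff d m x
    refine ⟨cT R d (m + 1) (y - z), ?_, _, ⟨x, rfl⟩, by rw [← hz, ← map_add, sub_add_cancel]⟩
    rw [← clsT_eq_zero, map_sub, sub_eq_zero]
    exact hx.symm.trans hz'
  · rintro ⟨a, ha, _, ⟨x, rfl⟩, h⟩
    obtain ⟨z, hz, hz'⟩ := exists_kdiff d m x
    refine ⟨clsT R (d + 1) m x, hz'.trans ?_⟩
    refine (sub_eq_zero.1 ((map_sub (clsT R d (m + 1)) y z).symm.trans ?_)).symm
    rw [clsT_eq_zero, map_sub, hz, ← h, add_sub_cancel_right]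
    exact ha

lemma mapT_Kd_succ_le (d m : ℕ) :
    mapT (Kd R (d + 1)) * mapT (⊤ : Submodule k ↥(TP k U m)) ≤
      mapT (Kd R d) * mapT (⊤ : Submodule k ↥(TP k U (1 + m))) := by
  refine (mul_le_mul_left (mapT_le_mapT.2 (Kd_succ_le (R := R) d)) _).trans_eq ?_
  rw [mulU, mapT_concatSub, mul_assoc, mapT_top_mul]

lemma kdiff_exact_iff (d m : ℕ) :
    Function.Exact ((kdiff R (d + 1)).f m) ((kdiff R d).f (m + 1)) ↔
      mapT (Kd R (d + 1)) * mapT (⊤ : Submodule k ↥(TP k U (m + 1))) ⊓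
        mapT (Kd R d) * mapT (Irel R (m + 2)) =
      mapT (Kd R (d + 1)) * mapT (Irel R (m + 1)) ⊔
        mapT (Kd R (d + 2)) * mapT (⊤ : Submodule k ↥(TP k U m)) := by
  have hle : mapT (Kd R (d + 1)) * mapT (Irel R (m + 1)) ⊔
        mapT (Kd R (d + 2)) * mapT (⊤ : Submodule k ↥(TP k U m)) ≤
      mapT (Kd R (d + 1)) * mapT (⊤ : Submodule k ↥(TP k U (m + 1))) := by
    refine sup_le (mul_le_mul_right (mapT_le_mapT.2 le_top) _) ?_
    have := mapT_Kd_succ_le (R := R) (d + 1) m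
    rwa [show mapT (⊤ : Submodule k ↥(TP k U (1 + m))) = mapT (⊤ : Submodule k ↥(TP k U (m + 1)))
      by rw [add_comm]] at this
  constructor
  · intro h
    ext a
    rw [Submodule.mem_inf]
    constructor
    · rintro ⟨ha, ha'⟩
      rw [← range_cT] at ha
      obtain ⟨y, rfl⟩ := ha
      exact kdiff_mem_range.1 ((h _).1 (kdiff_eq_zero.2 ha'))
    · intro ha
      refine ⟨hle ha, ?_⟩
      have ha' := hle ha
      rw [← range_cT] at ha'
      obtain ⟨y, rfl⟩ := ha'
      exact kdiff_eq_zero.1 ((h _).2 (kdiff_mem_range.2 ha))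
  · intro h y
    obtain ⟨y, rfl⟩ := clsT_surjective (d + 1) (m + 1) y
    refine kdiff_eq_zero.trans (Iff.trans ?_ kdiff_mem_range.symm)
    rw [← h, Submodule.mem_inf, ← range_cT]
    exact ⟨fun h => ⟨⟨y, rfl⟩, h⟩, fun h => h.2⟩

lemma mapT_Kt {ρ d m : ℕ} (h : d + m = ρ) :
    mapT (Kt k U (R.map (toTP2 k U).toLinearMap) ρ d) =
      mapT (Kd R d) * mapT (⊤ : Submodule k ↥(TP k U m)) := by
  subst h
  rw [Kt, dif_pos (Nat.le_add_right d m), mapT_castTP, mapT_concatSub, Nat.add_sub_cancel_left]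

lemma mapT_Kr {ρ d m : ℕ} (h : d + m = ρ) :
    mapT (Kr k U (R.map (toTP2 k U).toLinearMap) ρ d) = mapT (Kd R d) * mapT (Irel R m) := by
  subst h
  rw [Kr, dif_pos (Nat.le_add_right d m), mapT_castTP, mapT_concatSub, Nat.add_sub_cancel_left]
  rfl

lemma mapT_inf {n : ℕ} (S S' : Submodule k ↥(TP k U n)) : mapT (S ⊓ S') = mapT S ⊓ mapT S' :=
  Submodule.map_inf _ (toT_injective n)

lemma mapT_sup {n : ℕ} (S S' : Submodule k ↥(TP k U n)) : mapT (S ⊔ S') = mapT S ⊔ mapT S' :=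
  Submodule.map_sup _ _ _

lemma mapT_bot {n : ℕ} : mapT (⊥ : Submodule k ↥(TP k U n)) = ⊥ := Submodule.map_bot _

lemma mapT_Irel_succ (m : ℕ) : mapT (Irel R (m + 2)) =
    mapT (Irel R (m + 1)) * mapT (⊤ : Submodule k ↥(TP k U 1)) ⊔
      mapT (⊤ : Submodule k ↥(TP k U m)) * mapT (R.map (toTP2 k U).toLinearMap) := by
  rw [Irel, RelOf_succ, mapT_sup, mulU, mapT_concatSub, mapT_concatSub]
  rfl

lemma kdiff_exact_iff_Kt {ρ d m : ℕ} (h : d + m + 2 = ρ) :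
    Function.Exact ((kdiff R (d + 1)).f m) ((kdiff R d).f (m + 1)) ↔
      Kt k U (R.map (toTP2 k U).toLinearMap) ρ (d + 1) ⊓
        Kr k U (R.map (toTP2 k U).toLinearMap) ρ d =
      Kr k U (R.map (toTP2 k U).toLinearMap) ρ (d + 1) ⊔
        Kt k U (R.map (toTP2 k U).toLinearMap) ρ (d + 2) := by
  rw [kdiff_exact_iff, ← (mapT_injective (k := k) (U := U) ρ).eq_iff, mapT_inf, mapT_sup,
    mapT_Kt (d := d + 1) (m := m + 1) (by omega), mapT_Kr (d := d) (m := m + 2) (by omega),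
    mapT_Kr (d := d + 1) (m := m + 1) (by omega), mapT_Kt (d := d + 2) (m := m) (by omega)]

/-- Left multiplication by degree one elements exhausts positive degrees. -/
lemma kdiff_zero_surjective (m : ℕ) : Function.Surjective ((kdiff R 0).f m) := by
  intro y
  obtain ⟨y, rfl⟩ := clsT_surjective 0 (m + 1) y
  refine kdiff_mem_range.2 (le_sup_right (a := mapT (Kd R 0) * mapT (Irel R (m + 1))) ?_)
  have : cT R 0 (m + 1) y ∈ LinearMap.range (cT R 0 (m + 1)) := ⟨y, rfl⟩
  have h0 : mapT (Kd R 0) = 1 := by rw [Kd, Dual_zero, mapT_top_zero]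
  have h1 : Kd R (0 + 1) = ⊤ := Dual_one _
  rw [range_cT, h0, one_mul] at this
  rwa [h1, mapT_top_mul, add_comm (0 + 1) m]

end KoszulComplex

section KoszulCriterion

variable {k : Type} [Field k] {U : Type} [AddCommGroup U] [Module k U]
variable {R : Submodule k (U ⊗[k] U)}

lemma range_lTensor_of_rTensor {M N : Type} [AddCommGroup M] [Module k M] [AddCommGroup N]
    [Module k N] (S : Submodule k M) (S' : Submodule k N) (z : S ⊗[k] N)
    (h : S.subtype.rTensor N z ∈ LinearMap.range (S'.subtype.lTensor M)) :
    z ∈ LinearMap.range (S'.subtype.lTensor S) := by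
  have hex : Function.Exact S'.subtype S'.mkQ := LinearMap.exact_subtype_mkQ S'
  refine (lTensor_exact S hex S'.mkQ_surjective z).1 ?_
  apply Module.Flat.rTensor_preserves_injective_linearMap (M := N ⧸ S') S.subtype
    Subtype.val_injective
  rw [map_zero, ← LinearMap.comp_apply, LinearMap.rTensor_comp_lTensor,
    ← LinearMap.lTensor_comp_rTensor, LinearMap.comp_apply]
  exact (lTensor_exact M hex S'.mkQ_surjective _).2 h

lemma kdiff_exact_zero (d : ℕ) :
    Function.Exact ((kdiff R (d + 1)).f 0) ((kdiff R d).f 1) := by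
  rw [kdiff_exact_iff, mapT_Irel_succ, Irel_one, mapT_bot, Submodule.mul_bot, Submodule.bot_mul,
    bot_sup_eq, bot_sup_eq, mapT_top_zero, one_mul, mul_one]
  have hd : mapT (Kd R (d + 2)) = mapT (Kd R (d + 1)) * mapT (⊤ : Submodule k ↥(TP k U 1)) ⊓
      mapT (⊤ : Submodule k ↥(TP k U d)) * mapT (R.map (toTP2 k U).toLinearMap) := by
    rw [Kd, Dual_succ, mapT_inf, mulU, mapT_concatSub, mapT_concatSub]
  rw [hd]
  apply le_antisymm
  · exact inf_le_inf_left _ (mul_le_mul_left (mapT_le_mapT.2 le_top) _)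
  · refine le_inf inf_le_left ?_
    rintro a ⟨ha, ha'⟩
    have ha := mapT_Kd_succ_le d 1 ha
    rw [← range_cT] at ha
    obtain ⟨z, rfl⟩ := ha
    rw [cT_mem_iff]
    apply range_lTensor_of_rTensor
    have h2 : mapT (⊤ : Submodule k ↥(TP k U d)) * mapT (R.map (toTP2 k U).toLinearMap) =
        (LinearMap.range ((R.map (toTP2 k U).toLinearMap).subtype.lTensor ↥(TP k U d))).map
          (toT (d + 2) ∘ₗ (concatEquiv k U d 2).toLinearMap) := by
      rw [← mapT_concatSub, concatSub, mapT, ← Submodule.map_comp]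
      congr 1
      apply le_antisymm
      · rintro _ ⟨y, rfl⟩
        refine ⟨(⊤ : Submodule k ↥(TP k U d)).subtype.rTensor _ y, ?_⟩
        rw [← LinearMap.comp_apply, LinearMap.lTensor_comp_rTensor]
      · rintro _ ⟨y, rfl⟩
        refine ⟨(LinearMap.id.codRestrict ⊤ fun _ => trivial).rTensor _ y, ?_⟩
        rw [← LinearMap.comp_apply, LinearMap.map_comp_rTensor]
        rfl
    rw [h2] at ha'
    obtain ⟨y, hy, hyz⟩ := ha'
    have : y = (Kd R d).subtype.rTensor _ z :=
      (concatEquiv k U d 2).injective (toT_injective _ hyz)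
    rw [← this]
    exact hy

lemma kdiff_injective (d : ℕ) : Function.Injective ((kdiff R d).f 0) := by
  rw [injective_iff_map_eq_zero]
  intro y hy
  obtain ⟨y, rfl⟩ := clsT_surjective (d + 1) 0 y
  have := kdiff_eq_zero.1 hy
  rw [Irel_one, mapT_bot, Submodule.mul_bot, Submodule.mem_bot] at this
  rw [cT_injective (d + 1) 0 (this.trans (map_zero _).symm)]
  exact map_zero _

/-- Koszulness in terms of the differentials of free modules. -/
lemma isKoszul_iff : IsKoszul k U (R.map (toTP2 k U).toLinearMap) ↔
    ∀ d m, Function.Exact ((kdiff R (d + 1)).f m) ((kdiff R d).f (m + 1)) := by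
  constructor
  · intro h d m
    rw [kdiff_exact_iff_Kt rfl]
    exact h (d + m + 2) (by omega) (d + 1) (by omega)
  · intro h ρ hρ d hd
    cases d with
    | zero =>
      obtain ⟨ρ, rfl⟩ := Nat.exists_eq_add_of_le' hρ
      rw [if_pos rfl, inf_top_eq]
      apply mapT_injective
      rw [mapT_sup, mapT_Kt (d := 0) (m := ρ + 1) (by omega),
        mapT_Kr (d := 0) (m := ρ + 1) (by omega), mapT_Kt (d := 0 + 1) (m := ρ) (by omega), Kd,
        Dual_zero, mapT_top_zero, one_mul, one_mul]
      have h1 : Kd R (0 + 1) = ⊤ := Dual_one _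
      rw [h1, mapT_top_mul, add_comm (0 + 1) ρ, sup_eq_right.2 (mapT_le_mapT.2 le_top)]
    | succ d =>
      rw [if_neg (Nat.succ_ne_zero d), Nat.add_sub_cancel]
      obtain ⟨m, rfl⟩ := Nat.exists_eq_add_of_le hd
      cases m with
      | zero =>
        apply mapT_injective
        rw [mapT_sup, mapT_inf, mapT_Kr (d := d + 1) (m := 0) (by omega),
          mapT_Kr (d := d) (m := 1) (by omega), Irel_zero, Irel_one, mapT_bot, mapT_bot,
          Submodule.mul_bot, Submodule.mul_bot, inf_bot_eq, bot_sup_eq, Kt, dif_neg (by omega),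
          mapT_bot]
      | succ m => exact (kdiff_exact_iff_Kt (by omega)).1 (h d m)

lemma freeHom_zero_bijective {E : Type} [AddCommGroup E] [Module k E] (M : GMod R)
    (g : E →ₗ[k] M.X 0) (hg : Function.Bijective g) :
    Function.Bijective ((freeHom M g).f 0) := by
  refine (Function.Bijective.of_comp_iff _ (tmul_aone_bijective (R := R) E)).1 ?_
  convert hg using 1
  funext e
  exact freeHom_one M g e

variable (R) in
/-- The augmentation of the Koszul complex. -/
def kaug : GHom (Free R (Kd R 0)) (trivMod R k) :=
  freeHom (trivMod R k) (zeroEquiv.toLinearMap ∘ₗ (Kd R 0).subtype)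

lemma kaug_zero_bijective : Function.Bijective ((kaug R).f 0) := by
  have h : Function.Bijective (Kd R 0).subtype :=
    ⟨Subtype.val_injective, fun y => ⟨⟨y, by rw [Kd, Dual_zero]; trivial⟩, rfl⟩⟩
  exact freeHom_zero_bijective (trivMod R k) _
    ((zeroEquiv (k := k) (U := U)).bijective.comp h)

lemma kaug_surjective (n : ℕ) : Function.Surjective ((kaug R).f n) := by
  cases n with
  | zero => exact kaug_zero_bijective.2
  | succ n => exact fun y => ⟨0, (trivMod_subsingleton k n).elim _ _⟩

lemma kaug_exact (n : ℕ) : Function.Exact ((kdiff R 0).f n) ((kaug R).f (n + 1)) :=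
  fun y => ⟨fun _ => kdiff_zero_surjective n y, fun _ => (trivMod_subsingleton k n).elim _ _⟩

/-- The Koszul complex of a Koszul algebra resolves the trivial module. -/
lemma IsKoszul.resolution (h : IsKoszul k U (R.map (toTP2 k U).toLinearMap)) :
    Resolution (fun j => Free R (Kd R j)) (fun j => (kdiff R j).f) (kaug R) :=
  ⟨fun j => (kdiff R j).comm, kaug_surjective, kaug_zero_bijective.1, kaug_exact,
    kdiff_injective, isKoszul_iff.1 h⟩

variable (R) in
/-- A linear module whose generators and relations are the terms `d` and `d + 1` of the Koszul
complex. -/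
structure KCover (d : ℕ) (Y : GMod R) (g : GHom (Free R (Kd R d)) Y) : Prop where
  surj : ∀ n, Function.Surjective (g.f n)
  inj : Function.Injective (g.f 0)
  lin : ∀ t, Lin t Y
  exact_zero : Function.Exact ((kdiff R d).f 0) (g.f 1)

/-- The Koszul differential with values in the syzygies of a cover. -/
def KCover.next {d : ℕ} {Y : GMod R} {g : GHom (Free R (Kd R d)) Y} (h : KCover R d Y g) :
    GHom (Free R (Kd R (d + 1))) g.ker.shift where
  f n := ((kdiff R d).f n).codRestrict (LinearMap.ker (g.f (n + 1))) (by
    let φ : GHom (Free R (Kd R (d + 1))) Y.shift :=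
      ⟨fun n => g.f (n + 1) ∘ₗ (kdiff R d).f n, fun n x u =>
        (congrArg (g.f (n + 2)) ((kdiff R d).comm n x u)).trans (g.comm (n + 1) _ u)⟩
    let ψ : GHom (Free R (Kd R (d + 1))) Y.shift :=
      ⟨fun n => 0, fun n x u => by simp⟩
    intro x
    exact Free_hom_ext_apply φ ψ (fun e => (h.exact_zero _).2 ⟨_, rfl⟩) n x)
  comm n x u := Subtype.ext ((kdiff R d).comm n x u)

lemma KCover.lin_ker {d : ℕ} {Y : GMod R} {g : GHom (Free R (Kd R d)) Y} (h : KCover R d Y g)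
    (t : ℕ) : Lin t g.ker.shift :=
  Presentation.lin_of_free (ι := fun n => (LinearMap.ker (g.f (n + 1))).subtype) (g := g)
    ⟨fun _ _ _ => rfl, fun _ => Subtype.val_injective, fun _ => LinearMap.exact_subtype_ker_map _,
      h.surj, h.inj⟩ (ev_Free_bijective _) (h.lin (t + 1))

lemma KCover.next_cover {d : ℕ} {Y : GMod R} {g : GHom (Free R (Kd R d)) Y} (h : KCover R d Y g) :
    KCover R (d + 1) g.ker.shift h.next := by
  have h0 : Function.Surjective (h.next.f 0) := by
    rintro ⟨y, hy⟩
    obtain ⟨x, rfl⟩ := (h.exact_zero y).1 hy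
    exact ⟨x, rfl⟩
  refine ⟨fun n y => ?_, fun x y hxy => kdiff_injective d (congrArg Subtype.val hxy), h.lin_ker,
    fun y => ?_⟩
  · obtain ⟨x, rfl⟩ := (h.lin_ker 1).1 n y
    obtain ⟨x, rfl⟩ := LinearMap.rTensor_surjective _ h0 x
    exact ⟨_, ev_natural h.next n x⟩
  · exact ⟨fun hy => (kdiff_exact_zero d y).1 (congrArg Subtype.val hy),
      fun hy => Subtype.ext ((kdiff_exact_zero d y).2 hy)⟩

lemma KCover.exact {d : ℕ} {Y : GMod R} {g : GHom (Free R (Kd R d)) Y} (h : KCover R d Y g)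
    (n : ℕ) : Function.Exact ((kdiff R d).f n) (g.f (n + 1)) := by
  intro y
  constructor
  · intro hy
    obtain ⟨x, hx⟩ := h.next_cover.surj n ⟨y, hy⟩
    exact ⟨x, congrArg Subtype.val hx⟩
  · rintro ⟨x, rfl⟩
    exact (h.next.f n x).2

/-- If the trivial module has a linear resolution then the algebra is Koszul. -/
lemma isKoszul_of_lin (h : ∀ t, Lin t (trivMod R k)) :
    IsKoszul k U (R.map (toTP2 k U).toLinearMap) := by
  have key : ∀ d, ∃ Y g, KCover R d Y g := by
    intro d
    induction d with
    | zero => exact ⟨_, kaug R, kaug_surjective, kaug_zero_bijective.1, h, kaug_exact 0⟩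
    | succ d ih =>
      obtain ⟨Y, g, hg⟩ := ih
      exact ⟨_, _, hg.next_cover⟩
  rw [isKoszul_iff]
  intro d m y
  obtain ⟨Y, g, hg⟩ := key d
  rw [← hg.next_cover.exact m y]
  exact ⟨fun h => Subtype.ext h, fun h => congrArg Subtype.val h⟩

end KoszulCriterion

section TwistedProduct

variable {k : Type} [Field k] {V : Type} [AddCommGroup V] [Module k V]
variable {W : Type} [AddCommGroup W] [Module k W]
variable {R : Submodule k (V ⊗[k] V)} {S : Submodule k (W ⊗[k] W)}
variable {lam : (W ⊗[k] V) →ₗ[k] (V ⊗[k] W)}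

variable (R S lam) in
/-- The relations of the twisted product, as a subspace of `(V × W) ⊗ (V × W)`. -/
def twRel : Submodule k ((V × W) ⊗[k] (V × W)) :=
  R.map (TensorProduct.map (LinearMap.inl k V W) (LinearMap.inl k V W)) ⊔
    LinearMap.range (TensorProduct.map (LinearMap.inr k V W) (LinearMap.inl k V W) -
      TensorProduct.map (LinearMap.inl k V W) (LinearMap.inr k V W) ∘ₗ lam) ⊔
    S.map (TensorProduct.map (LinearMap.inr k V W) (LinearMap.inr k V W))

lemma relP_eq_map : relP k V W R S lam = (twRel R S lam).map (toTP2 k (V × W)).toLinearMap := by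
  rw [twRel, Submodule.map_sup, Submodule.map_sup, relP, embRR, embSS, embD, Submodule.map_comp,
    Submodule.map_comp, ← LinearMap.range_comp, LinearMap.comp_sub, LinearMap.comp_assoc]

lemma act2_compl₂ {U U' V V' X₀ X₁ X₂ : Type} [AddCommGroup U] [Module k U] [AddCommGroup U']
    [Module k U'] [AddCommGroup V] [Module k V] [AddCommGroup V'] [Module k V'] [AddCommGroup X₀]
    [Module k X₀] [AddCommGroup X₁] [Module k X₁] [AddCommGroup X₂] [Module k X₂]
    (a₀ : X₀ →ₗ[k] U →ₗ[k] X₁) (a₁ : X₁ →ₗ[k] U' →ₗ[k] X₂) (f : V →ₗ[k] U) (g : V' →ₗ[k] U')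
    (x : X₀) (r : V ⊗[k] V') :
    act2 (a₀.compl₂ f) (a₁.compl₂ g) x r = act2 a₀ a₁ x (TensorProduct.map f g r) := by
  induction r with
  | zero => simp
  | add r s hr hs => simp only [map_add, hr, hs]
  | tmul u u' => rfl

lemma act2_eq_zero {U U' X₀ X₁ X₂ Y : Type} [AddCommGroup U] [Module k U] [AddCommGroup U']
    [Module k U'] [AddCommGroup X₀] [Module k X₀] [AddCommGroup X₁] [Module k X₁]
    [AddCommGroup X₂] [Module k X₂] [AddCommGroup Y] [Module k Y]
    (a₀ : X₀ →ₗ[k] U →ₗ[k] X₁) (a₁ : X₁ →ₗ[k] U' →ₗ[k] X₂) (f : X₂ →ₗ[k] Y)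
    (x : X₀) (h : ∀ u u', f (a₁ (a₀ x u) u') = 0) (r : U ⊗[k] U') : f (act2 a₀ a₁ x r) = 0 := by
  induction r with
  | zero => simp
  | add r s hr hs => simp only [map_add, hr, hs, add_zero]
  | tmul u u' => exact h u u'

/-- The action of the first factor. -/
def GMod.actV (M : GMod (twRel R S lam)) (n : ℕ) : M.X n →ₗ[k] V →ₗ[k] M.X (n + 1) :=
  (M.act n).compl₂ (LinearMap.inl k V W)

/-- The action of the second factor. -/
def GMod.actW (M : GMod (twRel R S lam)) (n : ℕ) : M.X n →ₗ[k] W →ₗ[k] M.X (n + 1) :=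
  (M.act n).compl₂ (LinearMap.inr k V W)

lemma GMod.act_eq (M : GMod (twRel R S lam)) (n : ℕ) (x : M.X n) (u : V × W) :
    M.act n x u = M.actV n x u.1 + M.actW n x u.2 := by
  change _ = M.act n x (u.1, 0) + M.act n x (0, u.2)
  rw [← map_add, Prod.mk_add_mk, add_zero, zero_add]

lemma GMod.relV (M : GMod (twRel R S lam)) (n : ℕ) (x : M.X n) (r : V ⊗[k] V) (hr : r ∈ R) :
    act2 (M.actV n) (M.actV (n + 1)) x r = 0 := by
  rw [actV, actV, act2_compl₂]
  exact M.rel n x _ (Submodule.mem_sup_left (Submodule.mem_sup_left ⟨r, hr, rfl⟩))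

lemma GMod.relW (M : GMod (twRel R S lam)) (n : ℕ) (x : M.X n) (r : W ⊗[k] W) (hr : r ∈ S) :
    act2 (M.actW n) (M.actW (n + 1)) x r = 0 := by
  rw [actW, actW, act2_compl₂]
  exact M.rel n x _ (Submodule.mem_sup_right ⟨r, hr, rfl⟩)

lemma GMod.relVW (M : GMod (twRel R S lam)) (n : ℕ) (x : M.X n) (w : W) (v : V) :
    M.actV (n + 1) (M.actW n x w) v = act2 (M.actV n) (M.actW (n + 1)) x (lam (w ⊗ₜ v)) := by
  have := M.rel n x _ (Submodule.mem_sup_left (Submodule.mem_sup_right ⟨w ⊗ₜ v, rfl⟩))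
  rw [LinearMap.sub_apply, map_sub, sub_eq_zero] at this
  exact this.trans (act2_compl₂ _ _ _ _ _ _).symm

/-- A graded module over the twisted product, from the actions of the two factors. -/
def GMod.ofVW (X : ℕ → Type) [∀ n, AddCommGroup (X n)] [∀ n, Module k (X n)]
    (av : ∀ n, X n →ₗ[k] V →ₗ[k] X (n + 1)) (aw : ∀ n, X n →ₗ[k] W →ₗ[k] X (n + 1))
    (hv : ∀ n x, ∀ r ∈ R, act2 (av n) (av (n + 1)) x r = 0)
    (hw : ∀ n x, ∀ r ∈ S, act2 (aw n) (aw (n + 1)) x r = 0)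
    (hvw : ∀ n x w v,
      av (n + 1) (aw n x w) v = act2 (av n) (aw (n + 1)) x (lam (w ⊗ₜ v))) :
    GMod (twRel R S lam) where
  X := X
  act n := (av n).compl₂ (LinearMap.fst k V W) + (aw n).compl₂ (LinearMap.snd k V W)
  rel n x r hr := by
    have e1 : ∀ n, ((av n).compl₂ (LinearMap.fst k V W) +
        (aw n).compl₂ (LinearMap.snd k V W)).compl₂ (LinearMap.inl k V W) = av n := by
      intro n; ext; simp
    have e2 : ∀ n, ((av n).compl₂ (LinearMap.fst k V W) +
        (aw n).compl₂ (LinearMap.snd k V W)).compl₂ (LinearMap.inr k V W) = aw n := by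
      intro n; ext; simp
    have hq : act2 (aw n) (av (n + 1)) x = act2 (av n) (aw (n + 1)) x ∘ₗ lam :=
      TensorProduct.ext' fun w v => hvw n x w v
    obtain ⟨y, hy, z, hz, rfl⟩ := Submodule.mem_sup.1 hr
    obtain ⟨x', ⟨p, hp, rfl⟩, _, ⟨q, rfl⟩, rfl⟩ := Submodule.mem_sup.1 hy
    obtain ⟨s, hs, rfl⟩ := hz
    rw [LinearMap.sub_apply, LinearMap.comp_apply, map_add, map_add, map_sub, ← act2_compl₂,
      ← act2_compl₂, ← act2_compl₂, ← act2_compl₂, e1, e2, e1, e2, hv n x p hp, hw n x s hs,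
      add_zero, zero_add, sub_eq_zero]
    exact LinearMap.congr_fun hq q

end TwistedProduct

section Exchange

variable {k : Type} [Field k] {V : Type} [AddCommGroup V] [Module k V]
variable {W : Type} [AddCommGroup W] [Module k W]
variable {R : Submodule k (V ⊗[k] V)} {S : Submodule k (W ⊗[k] W)}
variable {lam : (W ⊗[k] V) →ₗ[k] (V ⊗[k] W)}

variable (lam) in
/-- Moving a letter of `V` to the left of two letters of `W`. -/
def exch1 : (W ⊗[k] W) ⊗[k] V →ₗ[k] V ⊗[k] (W ⊗[k] W) :=
  (TensorProduct.assoc k V W W).toLinearMap ∘ₗ lam.rTensor W ∘ₗ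
    (TensorProduct.assoc k W V W).symm.toLinearMap ∘ₗ lam.lTensor W ∘ₗ
    (TensorProduct.assoc k W W V).toLinearMap

variable (lam) in
/-- Moving a letter of `W` to the right of two letters of `V`. -/
def exch2 : W ⊗[k] (V ⊗[k] V) →ₗ[k] (V ⊗[k] V) ⊗[k] W :=
  (TensorProduct.assoc k V V W).symm.toLinearMap ∘ₗ lam.lTensor V ∘ₗ
    (TensorProduct.assoc k V W V).toLinearMap ∘ₗ lam.rTensor V ∘ₗ
    (TensorProduct.assoc k W V V).symm.toLinearMap

section

variable {U₀ U₁ U₂ X₀ X₁ X₂ X₃ : Type} [AddCommGroup U₀] [Module k U₀] [AddCommGroup U₁]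
  [Module k U₁] [AddCommGroup U₂] [Module k U₂] [AddCommGroup X₀] [Module k X₀] [AddCommGroup X₁]
  [Module k X₁] [AddCommGroup X₂] [Module k X₂] [AddCommGroup X₃] [Module k X₃]

lemma act2_assoc (a₀ : X₀ →ₗ[k] U₀ →ₗ[k] X₁) (a₁ : X₁ →ₗ[k] U₁ →ₗ[k] X₂)
    (a₂ : X₂ →ₗ[k] U₂ →ₗ[k] X₃) (x : X₀) (z : (U₀ ⊗[k] U₁) ⊗[k] U₂) :
    act2 a₀ (act2 a₁ a₂) x (TensorProduct.assoc k U₀ U₁ U₂ z) = act2 (act2 a₀ a₁) a₂ x z := by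
  have : act2 a₀ (act2 a₁ a₂) x ∘ₗ (TensorProduct.assoc k U₀ U₁ U₂).toLinearMap =
      act2 (act2 a₀ a₁) a₂ x := TensorProduct.ext_threefold fun _ _ _ => rfl
  exact LinearMap.congr_fun this z

lemma act2_assoc_symm (a₀ : X₀ →ₗ[k] U₀ →ₗ[k] X₁) (a₁ : X₁ →ₗ[k] U₁ →ₗ[k] X₂)
    (a₂ : X₂ →ₗ[k] U₂ →ₗ[k] X₃) (x : X₀) (z : U₀ ⊗[k] (U₁ ⊗[k] U₂)) :
    act2 (act2 a₀ a₁) a₂ x ((TensorProduct.assoc k U₀ U₁ U₂).symm z) =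
      act2 a₀ (act2 a₁ a₂) x z := by
  rw [← act2_assoc, LinearEquiv.apply_symm_apply]

lemma act2_lTensor {U₃ : Type} [AddCommGroup U₃] [Module k U₃]
    (a₀ : X₀ →ₗ[k] U₀ →ₗ[k] X₁) (a₁ : X₁ →ₗ[k] U₁ →ₗ[k] X₂) (a₂ : X₁ →ₗ[k] U₃ →ₗ[k] X₂)
    (f : U₁ →ₗ[k] U₃) (h : ∀ x u, a₁ x u = a₂ x (f u)) (x : X₀) (z : U₀ ⊗[k] U₁) :
    act2 a₀ a₁ x z = act2 a₀ a₂ x (f.lTensor U₀ z) := by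
  have : act2 a₀ a₁ x = act2 a₀ a₂ x ∘ₗ f.lTensor U₀ := TensorProduct.ext' fun _ _ => h _ _
  exact LinearMap.congr_fun this z

lemma act2_rTensor {U₃ : Type} [AddCommGroup U₃] [Module k U₃]
    (a₀ : X₀ →ₗ[k] U₀ →ₗ[k] X₁) (a₁ : X₁ →ₗ[k] U₁ →ₗ[k] X₂) (a₂ : X₀ →ₗ[k] U₃ →ₗ[k] X₁)
    (f : U₀ →ₗ[k] U₃) (h : ∀ x u, a₀ x u = a₂ x (f u)) (x : X₀) (z : U₀ ⊗[k] U₁) :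
    act2 a₀ a₁ x z = act2 a₂ a₁ x (f.rTensor U₁ z) := by
  have : act2 a₀ a₁ x = act2 a₂ a₁ x ∘ₗ f.rTensor U₁ :=
    TensorProduct.ext' fun u u' => congrArg (fun z => a₁ z u') (h _ _)
  exact LinearMap.congr_fun this z

lemma act2_range_lTensor (a₀ : X₀ →ₗ[k] U₀ →ₗ[k] X₁) (a₁ : X₁ →ₗ[k] U₁ →ₗ[k] X₂)
    (Q : Submodule k U₁) (h : ∀ y, ∀ q ∈ Q, a₁ y q = 0) (x : X₀) (z : U₀ ⊗[k] U₁)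
    (hz : z ∈ LinearMap.range (Q.subtype.lTensor U₀)) : act2 a₀ a₁ x z = 0 := by
  obtain ⟨z, rfl⟩ := hz
  have : act2 a₀ a₁ x ∘ₗ Q.subtype.lTensor U₀ = 0 :=
    TensorProduct.ext' fun u q => h (a₀ x u) q.1 q.2
  exact LinearMap.congr_fun this z

lemma act2_range_rTensor (a₀ : X₀ →ₗ[k] U₀ →ₗ[k] X₁) (a₁ : X₁ →ₗ[k] U₁ →ₗ[k] X₂)
    (Q : Submodule k U₀) (x : X₀) (h : ∀ q ∈ Q, a₀ x q = 0) (z : U₀ ⊗[k] U₁)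
    (hz : z ∈ LinearMap.range (Q.subtype.rTensor U₁)) : act2 a₀ a₁ x z = 0 := by
  obtain ⟨z, rfl⟩ := hz
  have : act2 a₀ a₁ x ∘ₗ Q.subtype.rTensor U₁ = 0 :=
    TensorProduct.ext' fun q u => by
      change a₁ (a₀ x q.1) u = 0
      rw [h q.1 q.2, map_zero, LinearMap.zero_apply]
  exact LinearMap.congr_fun this z

end

section

variable {X₀₀ X₀₁ X₀₂ X₁₀ X₁₁ X₁₂ X₂₀ X₂₁ : Type}
  [AddCommGroup X₀₀] [Module k X₀₀] [AddCommGroup X₀₁] [Module k X₀₁]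
  [AddCommGroup X₀₂] [Module k X₀₂] [AddCommGroup X₁₀] [Module k X₁₀]
  [AddCommGroup X₁₁] [Module k X₁₁] [AddCommGroup X₁₂] [Module k X₁₂]
  [AddCommGroup X₂₀] [Module k X₂₀] [AddCommGroup X₂₁] [Module k X₂₁]

lemma act2_swap {aw₀₀ : X₀₀ →ₗ[k] W →ₗ[k] X₀₁} {av₀₀ : X₀₀ →ₗ[k] V →ₗ[k] X₁₀}
    {av₀₁ : X₀₁ →ₗ[k] V →ₗ[k] X₁₁} {aw₁₀ : X₁₀ →ₗ[k] W →ₗ[k] X₁₁}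
    (h : ∀ x w v, av₀₁ (aw₀₀ x w) v = act2 av₀₀ aw₁₀ x (lam (w ⊗ₜ v))) (x : X₀₀)
    (z : W ⊗[k] V) : act2 aw₀₀ av₀₁ x z = act2 av₀₀ aw₁₀ x (lam z) := by
  have : act2 aw₀₀ av₀₁ x = act2 av₀₀ aw₁₀ x ∘ₗ lam := TensorProduct.ext' (h x)
  exact LinearMap.congr_fun this z

lemma exch2_act {aw₀₀ : X₀₀ →ₗ[k] W →ₗ[k] X₀₁} {av₀₀ : X₀₀ →ₗ[k] V →ₗ[k] X₁₀}
    {av₀₁ : X₀₁ →ₗ[k] V →ₗ[k] X₁₁} {aw₁₀ : X₁₀ →ₗ[k] W →ₗ[k] X₁₁}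
    {av₁₁ : X₁₁ →ₗ[k] V →ₗ[k] X₂₁} {av₁₀ : X₁₀ →ₗ[k] V →ₗ[k] X₂₀}
    {aw₂₀ : X₂₀ →ₗ[k] W →ₗ[k] X₂₁}
    (h₀ : ∀ x w v, av₀₁ (aw₀₀ x w) v = act2 av₀₀ aw₁₀ x (lam (w ⊗ₜ v)))
    (h₁ : ∀ x w v, av₁₁ (aw₁₀ x w) v = act2 av₁₀ aw₂₀ x (lam (w ⊗ₜ v)))
    (x : X₀₀) (w : W) (r : V ⊗[k] V) :
    act2 av₀₁ av₁₁ (aw₀₀ x w) r = act2 (act2 av₀₀ av₁₀) aw₂₀ x (exch2 lam (w ⊗ₜ r)) := by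
  calc _ = act2 aw₀₀ (act2 av₀₁ av₁₁) x (w ⊗ₜ r) := rfl
    _ = _ := by
      rw [← act2_assoc_symm, act2_rTensor _ av₁₁ (act2 av₀₀ aw₁₀) lam (act2_swap h₀),
        ← act2_assoc, act2_lTensor av₀₀ _ (act2 av₁₀ aw₂₀) lam (act2_swap h₁), ← act2_assoc_symm]
      rfl

lemma exch1_act {aw₀₀ : X₀₀ →ₗ[k] W →ₗ[k] X₀₁} {av₀₀ : X₀₀ →ₗ[k] V →ₗ[k] X₁₀}
    {av₀₁ : X₀₁ →ₗ[k] V →ₗ[k] X₁₁} {aw₁₀ : X₁₀ →ₗ[k] W →ₗ[k] X₁₁}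
    {aw₀₁ : X₀₁ →ₗ[k] W →ₗ[k] X₀₂} {av₀₂ : X₀₂ →ₗ[k] V →ₗ[k] X₁₂}
    {aw₁₁ : X₁₁ →ₗ[k] W →ₗ[k] X₁₂}
    (h₀ : ∀ x w v, av₀₁ (aw₀₀ x w) v = act2 av₀₀ aw₁₀ x (lam (w ⊗ₜ v)))
    (h₁ : ∀ x w v, av₀₂ (aw₀₁ x w) v = act2 av₀₁ aw₁₁ x (lam (w ⊗ₜ v)))
    (x : X₀₀) (s : W ⊗[k] W) (v : V) :
    av₀₂ (act2 aw₀₀ aw₀₁ x s) v = act2 av₀₀ (act2 aw₁₀ aw₁₁) x (exch1 lam (s ⊗ₜ v)) := by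
  calc _ = act2 (act2 aw₀₀ aw₀₁) av₀₂ x (s ⊗ₜ v) := rfl
    _ = _ := by
      rw [← act2_assoc, act2_lTensor aw₀₀ _ (act2 av₀₁ aw₁₁) lam (act2_swap h₁),
        ← act2_assoc_symm, act2_rTensor _ aw₁₁ (act2 av₀₀ aw₁₀) lam (act2_swap h₀), ← act2_assoc]
      rfl

end

section ReplacementRule

lemma Irel_two_le {U : Type} [AddCommGroup U] [Module k U] (Q : Submodule k (U ⊗[k] U)) :
    Irel Q 2 ≤ Q.map (toTP2 k U).toLinearMap := by
  refine Irel_succ_le ?_ ?_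
  · intro x hx u
    rw [Irel_one, Submodule.mem_bot] at hx
    rw [hx, zero_tmul, map_zero]; exact Submodule.zero_mem _
  · intro x r hr
    obtain ⟨c, rfl⟩ := zeroEquiv.symm.surjective x
    refine ⟨c • r, Submodule.smul_mem _ _ hr, ?_⟩
    have : c • (toTP2 k U).toLinearMap =
      act2 (TensorProduct.curry (stepEquiv k U 0).toLinearMap)
        (TensorProduct.curry (stepEquiv k U (0 + 1)).toLinearMap) (zeroEquiv.symm c) :=
      TensorProduct.ext' fun u u' => rfl
    rw [map_smul]
    exact LinearMap.congr_fun this r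

lemma actV_aone (v : V) : (Alg (twRel R S lam)).actV 0 (aone _) v =
    cls 1 (oneEquiv (LinearMap.inl k V W v)) :=
  congrArg (cls (R := twRel R S lam) 1) (show stepEquiv k (V × W) 0
    (zeroEquiv.symm 1 ⊗ₜ LinearMap.inl k V W v) = oneEquiv (LinearMap.inl k V W v) from
    one_smul k (LinearMap.inl k V W v))

lemma cls_mult12 (v : V) (s : W ⊗[k] W) :
    cls (R := twRel R S lam) 3 (concatEquiv k (V × W) 1 2
      (TensorProduct.map (TPmap k (LinearMap.inl k V W) 1) (TPmap k (LinearMap.inr k V W) 2)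
        (oneEquiv v ⊗ₜ toTP2 k W s))) =
    act2 ((Alg (twRel R S lam)).actW 1) ((Alg (twRel R S lam)).actW 2)
      ((Alg (twRel R S lam)).actV 0 (aone _) v) s := by
  rw [actV_aone]
  induction s with
  | zero => simp
  | add s t hs ht => simp only [map_add, tmul_add, hs, ht]
  | tmul w w' => rfl

lemma cls_mult21 (z : (V ⊗[k] V) ⊗[k] W) :
    cls (R := twRel R S lam) 3 (concatEquiv k (V × W) 2 1
      (TensorProduct.map (TPmap k (LinearMap.inl k V W) 2) (TPmap k (LinearMap.inr k V W) 1)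
        (TensorProduct.congr (toTP2 k V) oneEquiv z))) =
    act2 (act2 ((Alg (twRel R S lam)).actV 0) ((Alg (twRel R S lam)).actV 1))
      ((Alg (twRel R S lam)).actW 2) (aone _) z := by
  have : (cls (R := twRel R S lam) 3) ∘ₗ (concatEquiv k (V × W) 2 1).toLinearMap ∘ₗ
      (TensorProduct.map (TPmap k (LinearMap.inl k V W) 2) (TPmap k (LinearMap.inr k V W) 1)) ∘ₗ
      (TensorProduct.congr (toTP2 k V) (oneEquiv (U := W))).toLinearMap =
      act2 (act2 ((Alg (twRel R S lam)).actV 0) ((Alg (twRel R S lam)).actV 1))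
        ((Alg (twRel R S lam)).actW 2) (aone _) := by
    refine TensorProduct.ext_threefold fun v v' w => ?_
    rw [act2_tmul, act2_tmul, actV_aone]
    rfl
  exact LinearMap.congr_fun this z

lemma mem_ker_multVW {a b : ℕ} (z : ↥(TP k V a) ⊗[k] ↥(TP k W b)) :
    z ∈ LinearMap.ker (multVW k V W R S lam a b) ↔
      cls (R := twRel R S lam) (a + b) (concatEquiv k (V × W) a b
      (TensorProduct.map (TPmap k (LinearMap.inl k V W) a) (TPmap k (LinearMap.inr k V W) b)
        z)) = 0 := by
  rw [cls_eq_zero, Irel, ← relP_eq_map]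
  exact Submodule.Quotient.mk_eq_zero _

lemma exch1_mem [CharZero k] (h : IsReplacementRule k V W R S lam) (s : W ⊗[k] W) (hs : s ∈ S)
    (v : V) : exch1 lam (s ⊗ₜ v) ∈ LinearMap.range (S.subtype.lTensor V) := by
  let P := Alg (twRel R S lam)
  let e : V ⊗[k] (W ⊗[k] W) ≃ₗ[k] ↥(TP k V 1) ⊗[k] ↥(TP k W 2) :=
    TensorProduct.congr oneEquiv (toTP2 k W)
  have h1 : e (exch1 lam (s ⊗ₜ v)) ∈ denVW k V W R S 1 2 := by
    rw [← h.1, mem_ker_multVW]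
    have key : (cls (R := twRel R S lam) 3) ∘ₗ (concatEquiv k (V × W) 1 2).toLinearMap ∘ₗ
      (TensorProduct.map (TPmap k (LinearMap.inl k V W) 1) (TPmap k (LinearMap.inr k V W) 2)) ∘ₗ
        e.toLinearMap = act2 (P.actV 0) (act2 (P.actW 1) (P.actW 2)) (aone _) :=
      TensorProduct.ext' fun v s => cls_mult12 v s
    refine (LinearMap.congr_fun key _).trans ?_
    rw [← exch1_act (P.relVW 0) (P.relVW 1), P.relW 0 _ s hs, map_zero, LinearMap.zero_apply]
  have h2 : denVW k V W R S 1 2 ≤ (LinearMap.range (S.subtype.lTensor V)).map e.toLinearMap := by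
    refine sup_le ?_ ?_
    · rintro _ ⟨x, rfl⟩
      induction x with
      | zero => rw [map_zero]; exact Submodule.zero_mem _
      | add x y hx hy => rw [map_add]; exact Submodule.add_mem _ hx hy
      | tmul x y =>
        obtain ⟨x, hx⟩ := x
        rw [RelOf_one, Submodule.mem_bot] at hx
        subst hx
        rw [LinearMap.rTensor_tmul, Submodule.subtype_apply, zero_tmul]
        exact Submodule.zero_mem _
    · rintro _ ⟨x, rfl⟩
      induction x with
      | zero => rw [map_zero]; exact Submodule.zero_mem _
      | add x y hx hy => rw [map_add]; exact Submodule.add_mem _ hx hy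
      | tmul x y =>
        obtain ⟨y, hy⟩ := y
        obtain ⟨t, ht, rfl⟩ := Irel_two_le S hy
        exact ⟨_, ⟨oneEquiv.symm x ⊗ₜ ⟨t, ht⟩, rfl⟩, rfl⟩
  obtain ⟨z, hz, hz'⟩ := h2 h1
  rwa [← e.injective hz']

lemma exch2_mem [CharZero k] (h : IsReplacementRule k V W R S lam) (r : V ⊗[k] V) (hr : r ∈ R)
    (w : W) : exch2 lam (w ⊗ₜ r) ∈ LinearMap.range (R.subtype.rTensor W) := by
  let P := Alg (twRel R S lam)
  let e : (V ⊗[k] V) ⊗[k] W ≃ₗ[k] ↥(TP k V 2) ⊗[k] ↥(TP k W 1) :=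
    TensorProduct.congr (toTP2 k V) oneEquiv
  have h1 : e (exch2 lam (w ⊗ₜ r)) ∈ denVW k V W R S 2 1 := by
    rw [← h.2, mem_ker_multVW]
    refine (cls_mult21 _).trans ?_
    rw [← exch2_act (P.relVW 0) (P.relVW 1)]
    exact P.relV 1 _ r hr
  have h2 : denVW k V W R S 2 1 ≤ (LinearMap.range (R.subtype.rTensor W)).map e.toLinearMap := by
    refine sup_le ?_ ?_
    · rintro _ ⟨x, rfl⟩
      induction x with
      | zero => rw [map_zero]; exact Submodule.zero_mem _
      | add x y hx hy => rw [map_add]; exact Submodule.add_mem _ hx hy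
      | tmul x y =>
        obtain ⟨x, hx⟩ := x
        obtain ⟨t, ht, rfl⟩ := Irel_two_le R hx
        exact ⟨_, ⟨⟨t, ht⟩ ⊗ₜ oneEquiv.symm y, rfl⟩, rfl⟩
    · rintro _ ⟨x, rfl⟩
      induction x with
      | zero => rw [map_zero]; exact Submodule.zero_mem _
      | add x y hx hy => rw [map_add]; exact Submodule.add_mem _ hx hy
      | tmul x y =>
        obtain ⟨y, hy⟩ := y
        rw [RelOf_one, Submodule.mem_bot] at hy
        subst hy
        rw [LinearMap.lTensor_tmul, Submodule.subtype_apply, tmul_zero]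
        exact Submodule.zero_mem _
  obtain ⟨z, hz, hz'⟩ := h2 h1
  rwa [← e.injective hz']

end ReplacementRule

end Exchange

section Bigraded

variable {k : Type} [Field k] {V : Type} [AddCommGroup V] [Module k V]
variable {W : Type} [AddCommGroup W] [Module k W]

variable (R : Submodule k (V ⊗[k] V)) (S : Submodule k (W ⊗[k] W))
  (lam : (W ⊗[k] V) →ₗ[k] (V ⊗[k] W)) in
/-- Bigraded modules over the twisted product. -/
structure BiMod where
  /-- The homogeneous components. -/
  X : ℕ → ℕ → Type
  [acg : ∀ a b, AddCommGroup (X a b)]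
  [mod : ∀ a b, Module k (X a b)]
  /-- The action of the first factor. -/
  av : ∀ a b, X a b →ₗ[k] V →ₗ[k] X (a + 1) b
  /-- The action of the second factor. -/
  aw : ∀ a b, X a b →ₗ[k] W →ₗ[k] X a (b + 1)
  relV : ∀ a b x, ∀ r ∈ R, act2 (av a b) (av (a + 1) b) x r = 0
  relW : ∀ a b x, ∀ r ∈ S, act2 (aw a b) (aw a (b + 1)) x r = 0
  relVW : ∀ a b x w v,
    av a (b + 1) (aw a b x w) v = act2 (av a b) (aw (a + 1) b) x (lam (w ⊗ₜ v))

attribute [instance] BiMod.acg BiMod.mod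

variable {R : Submodule k (V ⊗[k] V)} {S : Submodule k (W ⊗[k] W)}
variable {lam : (W ⊗[k] V) →ₗ[k] (V ⊗[k] W)}

namespace BiMod

variable (N : BiMod R S lam)

/-- The families supported in total degree `m`. -/
def totX (m : ℕ) : Submodule k (∀ a b, N.X a b) where
  carrier := {f | ∀ a b, a + b ≠ m → f a b = 0}
  add_mem' {f g} hf hg a b h := by
    rw [Pi.add_apply, Pi.add_apply, hf a b h, hg a b h, add_zero]
  zero_mem' _ _ _ := rfl
  smul_mem' c f hf a b h := by rw [Pi.smul_apply, Pi.smul_apply, hf a b h, smul_zero]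

/-- The component of bidegree `(a, b)`. -/
def comp (m a b : ℕ) : N.totX m →ₗ[k] N.X a b :=
  LinearMap.proj b ∘ₗ LinearMap.proj a ∘ₗ (N.totX m).subtype

lemma totX_ext {m : ℕ} {f g : N.totX m} (h : ∀ a b, a + b = m → N.comp m a b f = N.comp m a b g) :
    f = g := by
  refine Subtype.ext (funext fun a => funext fun b => ?_)
  by_cases hab : a + b = m
  · exact h a b hab
  · exact (f.2 a b hab).trans (g.2 a b hab).symm

/-- The action of the first factor on families. -/
def famV (f : ∀ a b, N.X a b) (v : V) : ∀ a b, N.X a b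
  | 0, _ => 0
  | a + 1, b => N.av a b (f a b) v

/-- The action of the second factor on families. -/
def famW (f : ∀ a b, N.X a b) (w : W) : ∀ a b, N.X a b
  | _, 0 => 0
  | a, b + 1 => N.aw a b (f a b) w

/-- The action of the first factor on the total module. -/
def totV (m : ℕ) : N.totX m →ₗ[k] V →ₗ[k] N.totX (m + 1) :=
  LinearMap.mk₂ k (fun f v => ⟨N.famV f.1 v, by
      rintro (_ | a) b h
      · rfl
      · change N.av a b (f.1 a b) v = 0
        rw [f.2 a b (by omega), map_zero, LinearMap.zero_apply]⟩)
    (by intros; apply Subtype.ext; funext a b; cases a <;> simp [famV])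
    (by intros; apply Subtype.ext; funext a b; cases a <;> simp [famV])
    (by intros; apply Subtype.ext; funext a b; cases a <;> simp [famV])
    (by intros; apply Subtype.ext; funext a b; cases a <;> simp [famV])

/-- The action of the second factor on the total module. -/
def totW (m : ℕ) : N.totX m →ₗ[k] W →ₗ[k] N.totX (m + 1) :=
  LinearMap.mk₂ k (fun f v => ⟨N.famW f.1 v, by
      rintro a (_ | b) h
      · rfl
      · change N.aw a b (f.1 a b) v = 0
        rw [f.2 a b (by omega), map_zero, LinearMap.zero_apply]⟩)
    (by intros; apply Subtype.ext; funext a b; cases b <;> simp [famW])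
    (by intros; apply Subtype.ext; funext a b; cases b <;> simp [famW])
    (by intros; apply Subtype.ext; funext a b; cases b <;> simp [famW])
    (by intros; apply Subtype.ext; funext a b; cases b <;> simp [famW])

lemma comp_totV_zero (m b : ℕ) (f : N.totX m) (v : V) :
    N.comp (m + 1) 0 b (N.totV m f v) = 0 := rfl

lemma comp_totV_succ (m a b : ℕ) (f : N.totX m) (v : V) :
    N.comp (m + 1) (a + 1) b (N.totV m f v) = N.av a b (N.comp m a b f) v := rfl

lemma comp_totW_zero (m a : ℕ) (f : N.totX m) (w : W) :
    N.comp (m + 1) a 0 (N.totW m f w) = 0 := rfl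

lemma comp_totW_succ (m a b : ℕ) (f : N.totX m) (w : W) :
    N.comp (m + 1) a (b + 1) (N.totW m f w) = N.aw a b (N.comp m a b f) w := rfl

/-- The total module of a bigraded module. -/
def tot : GMod (twRel R S lam) := by
  refine GMod.ofVW (fun m => N.totX m) N.totV N.totW ?_ ?_ ?_
  · intro m f r hr
    refine N.totX_ext fun a b _ => ?_
    rw [map_zero]
    match a with
    | 0 => exact act2_eq_zero _ _ _ _ (fun u u' => rfl) r
    | 1 =>
      refine act2_eq_zero _ _ _ _ (fun u u' => ?_) r
      rw [comp_totV_succ, comp_totV_zero, map_zero, LinearMap.zero_apply]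
    | a + 2 =>
      exact (act2_map _ _ (N.av a b) (N.av (a + 1) b) (N.comp m a b) (N.comp (m + 1) (a + 1) b)
        (N.comp (m + 2) (a + 2) b) (fun _ _ => rfl) (fun _ _ => rfl) f r).trans (N.relV a b _ r hr)
  · intro m f r hr
    refine N.totX_ext fun a b _ => ?_
    rw [map_zero]
    match b with
    | 0 => exact act2_eq_zero _ _ _ _ (fun u u' => rfl) r
    | 1 =>
      refine act2_eq_zero _ _ _ _ (fun u u' => ?_) r
      rw [comp_totW_succ, comp_totW_zero, map_zero, LinearMap.zero_apply]
    | b + 2 =>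
      exact (act2_map _ _ (N.aw a b) (N.aw a (b + 1)) (N.comp m a b) (N.comp (m + 1) a (b + 1))
        (N.comp (m + 2) a (b + 2)) (fun _ _ => rfl) (fun _ _ => rfl) f r).trans (N.relW a b _ r hr)
  · intro m f w v
    refine N.totX_ext fun a b _ => ?_
    match a, b with
    | 0, 0 => exact (act2_eq_zero _ _ _ _ (fun u u' => rfl) _).symm
    | 0, b + 1 =>
      refine (act2_eq_zero _ _ _ _ (fun u u' => ?_) _).symm
      rw [comp_totW_succ, comp_totV_zero, map_zero, LinearMap.zero_apply]
    | a + 1, 0 =>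
      rw [comp_totV_succ, comp_totW_zero, map_zero, LinearMap.zero_apply]
      exact (act2_eq_zero _ _ _ _ (fun u u' => rfl) _).symm
    | a + 1, b + 1 =>
      rw [comp_totV_succ, comp_totW_succ, N.relVW]
      exact (act2_map _ _ (N.av a b) (N.aw (a + 1) b) (N.comp m a b) (N.comp (m + 1) (a + 1) b)
        (N.comp (m + 2) (a + 1) (b + 1)) (fun _ _ => rfl) (fun _ _ => rfl) f _).symm

end BiMod

section Twist

variable (lam) in
/-- The action of `W` on operators obtained by exchange. -/
def exchOp {X Y : Type} [AddCommGroup X] [Module k X] [AddCommGroup Y] [Module k Y]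
    (a : X →ₗ[k] W →ₗ[k] Y) : (V →ₗ[k] X) →ₗ[k] W →ₗ[k] (V →ₗ[k] Y) :=
  LinearMap.mk₂ k (fun h w => act2 LinearMap.id a h ∘ₗ lam ∘ₗ TensorProduct.mk k W V w)
    (by intros; ext; simp) (by intros; ext; simp) (by intros; ext; simp) (by intros; ext; simp)

variable (h₁ : ∀ s ∈ S, ∀ v, exch1 lam (s ⊗ₜ v) ∈ LinearMap.range (S.subtype.lTensor V))

/-- The module of operators in which the exchange of `V` with the second factor lives. -/
def exchMod : GMod S where
  X b := V →ₗ[k] V ⊗[k] (Alg S).X b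
  act b := exchOp lam ((tens V (Alg S)).act b)
  rel b h s hs := by
    refine LinearMap.ext fun v => ?_
    refine (exch1_act (lam := lam) (av₀₀ := LinearMap.id) (av₀₁ := LinearMap.id)
      (av₀₂ := LinearMap.id) (aw₁₀ := (tens V (Alg S)).act b)
      (aw₁₁ := (tens V (Alg S)).act (b + 1)) ?_ ?_ h s v).trans ?_
    · exact fun _ _ _ => rfl
    · exact fun _ _ _ => rfl
    · exact act2_range_lTensor _ _ S ((tens V (Alg S)).rel b) h _ (h₁ s hs v)

/-- The exchange of `V` with the second factor. -/
def lamB (b : ℕ) : (Alg S).X b →ₗ[k] V →ₗ[k] V ⊗[k] (Alg S).X b :=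
  ev (exchMod h₁) b ∘ₗ TensorProduct.mk k (V →ₗ[k] V ⊗[k] (Alg S).X 0) _
    ((TensorProduct.mk k V ((Alg S).X 0)).flip (aone S))

lemma lamB_aone (v : V) : lamB h₁ 0 (aone S) v = v ⊗ₜ aone S :=
  LinearMap.congr_fun (ev_one (exchMod h₁) _) v

lemma lamB_act (b : ℕ) (β : (Alg S).X b) (w : W) (v : V) :
    lamB h₁ (b + 1) ((Alg S).act b β w) v =
      act2 (lamB h₁ b) ((tens V (Alg S)).act b) β (lam (w ⊗ₜ v)) :=
  LinearMap.congr_fun (ev_act (exchMod h₁) b _ β w) v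

/-- The action of `V` on `M ⊗ B`. -/
def indV (M : GMod R) (a b : ℕ) :
    M.X a ⊗[k] (Alg S).X b →ₗ[k] V →ₗ[k] M.X (a + 1) ⊗[k] (Alg S).X b :=
  TensorProduct.lift (LinearMap.mk₂ k
    (fun m β => (M.act a m).rTensor ((Alg S).X b) ∘ₗ lamB h₁ b β)
    (by intros; simp [LinearMap.rTensor_add, LinearMap.add_comp])
    (by intros; simp [LinearMap.rTensor_smul, LinearMap.smul_comp])
    (by intros; simp [LinearMap.comp_add])
    (by intros; simp [LinearMap.comp_smul]))

lemma indV_tmul (M : GMod R) (a b : ℕ) (m : M.X a) (β : (Alg S).X b) (v : V) :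
    indV h₁ M a b (m ⊗ₜ β) v = (M.act a m).rTensor _ (lamB h₁ b β v) := rfl

lemma indV_aone (M : GMod R) (a : ℕ) (m : M.X a) (v : V) :
    indV h₁ M a 0 (m ⊗ₜ aone S) v = M.act a m v ⊗ₜ aone S := by
  rw [indV_tmul, lamB_aone, LinearMap.rTensor_tmul]

lemma indV_relVW (M : GMod R) (a b : ℕ) (x : M.X a ⊗[k] (Alg S).X b) (w : W) (v : V) :
    indV h₁ M a (b + 1) ((tens (M.X a) (Alg S)).act b x w) v =
      act2 (indV h₁ M a b) ((tens (M.X (a + 1)) (Alg S)).act b) x (lam (w ⊗ₜ v)) := by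
  have key : (indV h₁ M a (b + 1)).flip v ∘ₗ ((tens (M.X a) (Alg S)).act b).flip w =
      (act2 (indV h₁ M a b) ((tens (M.X (a + 1)) (Alg S)).act b)).flip (lam (w ⊗ₜ v)) := by
    refine TensorProduct.ext' fun m β => ?_
    refine (congrArg ((M.act a m).rTensor _) (lamB_act h₁ b β w v)).trans ?_
    exact act2_map _ _ (indV h₁ M a b) ((tens (M.X (a + 1)) (Alg S)).act b) (fun β => m ⊗ₜ β)
      ((M.act a m).rTensor _) ((M.act a m).rTensor _) (fun _ _ => rfl)
      (fun x u => (mapTens (M.act a m) (Alg S)).comm b x u) β _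
  exact LinearMap.congr_fun key x

lemma indV_relV
    (h₂ : ∀ r ∈ R, ∀ w, exch2 lam (w ⊗ₜ r) ∈ LinearMap.range (R.subtype.rTensor W))
    (M : GMod R) (a b : ℕ) (x : M.X a ⊗[k] (Alg S).X b) (r : V ⊗[k] V)
    (hr : r ∈ R) :
    act2 (indV h₁ M a b) (indV h₁ M (a + 1) b) x r = 0 := by
  induction x with
  | zero => rw [map_zero, LinearMap.zero_apply]
  | add x y hx hy => rw [map_add, LinearMap.add_apply, hx, hy, add_zero]
  | tmul m β =>
    refine Alg_induction (motive := fun b β => ∀ r ∈ R,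
      act2 (indV h₁ M a b) (indV h₁ M (a + 1) b) (m ⊗ₜ β) r = 0) ?_ ?_ ?_ b β r hr
    · intro n x y hx hy r hr
      rw [tmul_add, map_add, LinearMap.add_apply, hx r hr, hy r hr, add_zero]
    · intro c r hr
      rw [← smul_tmul]
      refine (act2_map (M.act a) (M.act (a + 1)) _ _ (fun m => m ⊗ₜ aone S)
        (fun m => m ⊗ₜ aone S) ((TensorProduct.mk k _ _).flip (aone S))
        (fun m v => (indV_aone h₁ M a m v).symm) (fun m v => (indV_aone h₁ M (a + 1) m v).symm)
        (c • m) r).symm.trans ?_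
      rw [M.rel a _ r hr, map_zero]
    · intro b β w hβ r hr
      exact (exch2_act (indV_relVW h₁ M a b) (indV_relVW h₁ M (a + 1) b) (m ⊗ₜ β) w r).trans
        (act2_range_rTensor _ _ R _ hβ _ (h₂ r hr w))

variable (h₂ : ∀ r ∈ R, ∀ w, exch2 lam (w ⊗ₜ r) ∈ LinearMap.range (R.subtype.rTensor W))

/-- The bigraded module `M ⊗ B` induced from a module over the first factor. -/
def ind (M : GMod R) : BiMod R S lam where
  X a b := M.X a ⊗[k] (Alg S).X b
  av := indV h₁ M
  aw a b := (tens (M.X a) (Alg S)).act b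
  relV := indV_relV h₁ h₂ M
  relW a b := (tens (M.X a) (Alg S)).rel b
  relVW := indV_relVW h₁ M

end Twist

end Bigraded

section ConstantModule

variable {k : Type} [Field k] {U : Type} [AddCommGroup U] [Module k U]

lemma act2_map_apply {U' X₀ X₁ X₂ Y₀ Y₁ Y₂ : Type} [AddCommGroup U'] [Module k U']
    [AddCommGroup X₀] [Module k X₀] [AddCommGroup X₁] [Module k X₁] [AddCommGroup X₂] [Module k X₂]
    [AddCommGroup Y₀] [Module k Y₀] [AddCommGroup Y₁] [Module k Y₁] [AddCommGroup Y₂] [Module k Y₂]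
    (a₀ : X₀ →ₗ[k] U →ₗ[k] X₁) (a₁ : X₁ →ₗ[k] U' →ₗ[k] X₂)
    (b₀ : Y₀ →ₗ[k] U →ₗ[k] Y₁) (b₁ : Y₁ →ₗ[k] U' →ₗ[k] Y₂)
    (f₁ : X₁ → Y₁) (f₂ : X₂ →ₗ[k] Y₂) (x : X₀) (y : Y₀)
    (h₀ : ∀ u, f₁ (a₀ x u) = b₀ y u) (h₁ : ∀ x u, f₂ (a₁ x u) = b₁ (f₁ x) u)
    (r : U ⊗[k] U') : f₂ (act2 a₀ a₁ x r) = act2 b₀ b₁ y r := by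
  induction r with
  | zero => simp
  | add r s hr hs => simp only [map_add, hr, hs]
  | tmul u u' => simp [h₀, h₁]

variable {R : Submodule k (U ⊗[k] U)}

/-- The action of generators on families. -/
def famAct (Q : GMod R) (f : ∀ i, Q.X i) (u : U) : ∀ i, Q.X i
  | 0 => 0
  | i + 1 => Q.act i (f i) u

/-- The action of generators on families, as a bilinear map. -/
def famActHom (Q : GMod R) : (∀ i, Q.X i) →ₗ[k] U →ₗ[k] (∀ i, Q.X i) :=
  LinearMap.mk₂ k (famAct Q)
    (by intros; funext i; cases i <;> simp [famAct])
    (by intros; funext i; cases i <;> simp [famAct])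
    (by intros; funext i; cases i <;> simp [famAct])
    (by intros; funext i; cases i <;> simp [famAct])

/-- The product of the components of a graded module, placed in all degrees. -/
def constMod (Q : GMod R) : GMod R where
  X _ := ∀ i, Q.X i
  act _ := famActHom Q
  rel _ f r hr := by
    funext i
    match i with
    | 0 =>
      exact act2_eq_zero (famActHom Q) (famActHom Q) (LinearMap.proj (R := k) (φ := Q.X) 0) f
        (fun u u' => rfl) r
    | 1 =>
      refine act2_eq_zero (famActHom Q) (famActHom Q) (LinearMap.proj (R := k) (φ := Q.X) 1) f
        (fun u u' => ?_) r
      change Q.act 0 0 u' = 0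
      rw [map_zero, LinearMap.zero_apply]
    | i + 2 =>
      exact (act2_map (famActHom Q) (famActHom Q) (Q.act i) (Q.act (i + 1)) (LinearMap.proj (R := k) (φ := Q.X) i)
        (LinearMap.proj (R := k) (φ := Q.X) (i + 1)) (LinearMap.proj (R := k) (φ := Q.X) (i + 2)) (fun _ _ => rfl) (fun _ _ => rfl) f r).trans
        (Q.rel i _ r hr)

/-- The inclusion of a graded module in the product of its components. -/
def inclConst (Q : GMod R) : GHom Q (constMod Q) where
  f n := LinearMap.single k Q.X n
  comm n x u := by
    funext i
    change Pi.single (n + 1) (Q.act n x u) i = famAct Q (Pi.single n x) u i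
    match i with
    | 0 => rw [Pi.single_eq_of_ne (by omega)]; rfl
    | i + 1 =>
      change _ = Q.act i (Pi.single (M := Q.X) n x i) u
      by_cases h : i = n
      · subst h; rw [Pi.single_eq_same, Pi.single_eq_same]
      · rw [Pi.single_eq_of_ne (by omega), Pi.single_eq_of_ne h, map_zero, LinearMap.zero_apply]

lemma inclConst_injective (Q : GMod R) (n : ℕ) : Function.Injective ((inclConst Q).f n) :=
  Pi.single_injective n

end ConstantModule

section Bigraded

variable {k : Type} [Field k] {V : Type} [AddCommGroup V] [Module k V]
variable {W : Type} [AddCommGroup W] [Module k W]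
variable {R : Submodule k (V ⊗[k] V)} {S : Submodule k (W ⊗[k] W)}
variable {lam : (W ⊗[k] V) →ₗ[k] (V ⊗[k] W)}

namespace BiMod

variable (N : BiMod R S lam)

lemma tot_act (m : ℕ) (f : N.totX m) (u : V × W) :
    N.tot.act m f u = (N.totV m f u.1 + N.totW m f u.2 : N.totX (m + 1)) := rfl

/-- The inclusion of a bigraded component. -/
def single {m a b : ℕ} (h : a + b = m) : N.X a b →ₗ[k] N.totX m :=
  LinearMap.codRestrict (N.totX m)
    (LinearMap.single k (fun a => ∀ b, N.X a b) a ∘ₗ LinearMap.single k (N.X a) b) (by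
      intro x a' b' h'
      change Pi.single (M := fun a => ∀ b, N.X a b) a (Pi.single b x) a' b' = 0
      by_cases ha : a' = a
      · subst ha
        rw [Pi.single_eq_same, Pi.single_eq_of_ne]
        omega
      · rw [Pi.single_eq_of_ne ha]; rfl)

lemma comp_single_self {m a b : ℕ} (h : a + b = m) (x : N.X a b) :
    N.comp m a b (N.single h x) = x := by
  change Pi.single (M := fun a => ∀ b, N.X a b) a (Pi.single b x) a b = x
  rw [Pi.single_eq_same, Pi.single_eq_same]

lemma comp_single_ne {m a b a' b' : ℕ} (h : a + b = m) (x : N.X a b)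
    (ha : a' ≠ a) : N.comp m a' b' (N.single h x) = 0 := by
  change Pi.single (M := fun a => ∀ b, N.X a b) a (Pi.single b x) a' b' = 0
  rw [Pi.single_eq_of_ne ha]; rfl

lemma totV_single {m a b : ℕ} (h : a + b = m) (x : N.X a b) (v : V) :
    N.totV m (N.single h x) v = N.single (m := m + 1) (by omega) (N.av a b x v) := by
  refine N.totX_ext fun a' b' h' => ?_
  match a' with
  | 0 => rw [comp_totV_zero, comp_single_ne _ _ _ (by omega)]
  | a' + 1 =>
    rw [comp_totV_succ]
    by_cases ha : a' = a
    · subst ha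
      obtain rfl : b' = b := by omega
      rw [comp_single_self, comp_single_self]
    · rw [comp_single_ne _ _ _ ha, comp_single_ne _ _ _ (by omega), map_zero,
        LinearMap.zero_apply]

lemma totW_single {m a b : ℕ} (h : a + b = m) (x : N.X a b) (w : W) :
    N.totW m (N.single h x) w = N.single (m := m + 1) (by omega) (N.aw a b x w) := by
  refine N.totX_ext fun a' b' h' => ?_
  match b' with
  | 0 => rw [comp_totW_zero, comp_single_ne _ _ _ (by omega)]
  | b' + 1 =>
    rw [comp_totW_succ]
    by_cases ha : a' = a
    · subst ha
      obtain rfl : b' = b := by omega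
      rw [comp_single_self, comp_single_self]
    · rw [comp_single_ne _ _ _ ha, comp_single_ne _ _ _ ha, map_zero,
        LinearMap.zero_apply]

lemma mem_of_single_mem {m : ℕ} (Q : Submodule k (N.totX m))
    (hQ : ∀ a b (h : a + b = m) x, N.single h x ∈ Q) (f : N.totX m) : f ∈ Q := by
  have : f = ∑ p ∈ (Finset.HasAntidiagonal.antidiagonal m).attach,
      N.single (Finset.HasAntidiagonal.mem_antidiagonal.1 p.2) (N.comp m p.1.1 p.1.2 f) := by
    refine N.totX_ext fun a b h => ?_
    rw [map_sum, Finset.sum_eq_single ⟨(a, b), Finset.HasAntidiagonal.mem_antidiagonal.2 h⟩]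
    · exact (N.comp_single_self _ _).symm
    · rintro ⟨⟨a', b'⟩, hp⟩ - hne
      have hp' := Finset.HasAntidiagonal.mem_antidiagonal.1 hp
      refine N.comp_single_ne _ _ fun ha => hne ?_
      dsimp only at ha hp'
      exact Subtype.ext (Prod.ext ha.symm (by dsimp only; omega))
    · exact fun h => absurd (Finset.mem_attach _ _) h
  rw [this]
  exact Submodule.sum_mem _ fun p _ => hQ _ _ _ _

end BiMod

section Free

variable (h₁ : ∀ s ∈ S, ∀ v, exch1 lam (s ⊗ₜ v) ∈ LinearMap.range (S.subtype.lTensor V))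
variable (h₂ : ∀ r ∈ R, ∀ w, exch2 lam (w ⊗ₜ r) ∈ LinearMap.range (R.subtype.rTensor W))
variable (E : Type) [AddCommGroup E] [Module k E]

/-- The comparison morphism from a free module over the twisted product to the total module of the
module induced from a free module over the first factor. -/
def freeInd : GHom (Free (twRel R S lam) E) (ind h₁ h₂ (Free R E)).tot :=
  freeHom _ ((ind h₁ h₂ (Free R E)).single (rfl : 0 + 0 = 0) ∘ₗ
    (TensorProduct.mk k (E ⊗[k] (Alg R).X 0) ((Alg S).X 0)).flip (aone S) ∘ₗ
    (TensorProduct.mk k E ((Alg R).X 0)).flip (aone R))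

lemma freeInd_one (e : E) : (freeInd h₁ h₂ E).f 0 (e ⊗ₜ aone _ : E ⊗[k] _) =
    (ind h₁ h₂ (Free R E)).single (rfl : 0 + 0 = 0) ((e ⊗ₜ[k] aone R) ⊗ₜ[k] aone S) :=
  freeHom_one _ _ e

lemma mem_of_closed (rg : ∀ m, Submodule k ((ind h₁ h₂ (Free R E)).totX m))
    (hV : ∀ m f v, f ∈ rg m → (ind h₁ h₂ (Free R E)).totV m f v ∈ rg (m + 1))
    (hW : ∀ m f w, f ∈ rg m → (ind h₁ h₂ (Free R E)).totW m f w ∈ rg (m + 1))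
    (h0 : ∀ e : E, (ind h₁ h₂ (Free R E)).single (rfl : 0 + 0 = 0)
      ((e ⊗ₜ[k] aone R) ⊗ₜ[k] aone S) ∈ rg 0) (m : ℕ) (f : (ind h₁ h₂ (Free R E)).totX m) :
    f ∈ rg m := by
  let N := ind h₁ h₂ (Free R E)
  have hα : ∀ (e : E) a (α : (Alg R).X a), (e ⊗ₜ[k] α : E ⊗[k] (Alg R).X a) ⊗ₜ[k] aone S ∈
      (rg a).comap (N.single (rfl : a + 0 = a)) := by
    intro e a α
    refine Alg_induction (motive := fun a α => (e ⊗ₜ[k] α : E ⊗[k] (Alg R).X a) ⊗ₜ[k] aone S ∈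
      (rg a).comap (N.single (rfl : a + 0 = a))) ?_ ?_ ?_ a α
    · intro a x y hx hy
      rw [tmul_add, add_tmul]
      exact Submodule.add_mem _ hx hy
    · intro c
      rw [← smul_tmul]
      exact h0 (c • e)
    · intro a x v hx
      have h := indV_aone h₁ (Free R E) a (e ⊗ₜ[k] x : E ⊗[k] (Alg R).X a) v
      exact (congrArg (· ∈ rg (a + 1)) ((N.totV_single (rfl : a + 0 = a) _ v).trans
        (congrArg (N.single (rfl : a + 1 + 0 = a + 1)) h))).mp (hV _ _ v hx)
  have hβ : ∀ a b (x : E ⊗[k] (Alg R).X a) (β : (Alg S).X b),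
      x ⊗ₜ[k] β ∈ (rg (a + b)).comap (N.single (rfl : a + b = a + b)) := by
    intro a b x β
    refine Alg_induction (motive := fun b β =>
      x ⊗ₜ[k] β ∈ (rg (a + b)).comap (N.single (rfl : a + b = a + b))) ?_ ?_ ?_ b β
    · intro b y z hy hz
      rw [tmul_add]
      exact Submodule.add_mem _ hy hz
    · intro c
      rw [← smul_tmul]
      generalize c • x = x
      induction x with
      | zero => rw [zero_tmul]; exact Submodule.zero_mem _
      | add x y hx hy => rw [add_tmul]; exact Submodule.add_mem _ hx hy
      | tmul e α => exact hα e a α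
    · intro b y w hy
      exact (congrArg (· ∈ rg (a + b + 1))
        (N.totW_single (rfl : a + b = a + b) _ w)).mp (hW _ _ w hy)
  have hγ : ∀ a b, (rg (a + b)).comap (N.single (rfl : a + b = a + b)) = ⊤ := by
    refine fun a b => eq_top_iff.2 ?_
    change ∀ x : (E ⊗[k] (Alg R).X a) ⊗[k] (Alg S).X b, _
    intro x _
    induction x with
    | zero => exact Submodule.zero_mem _
    | add x y hx hy => exact Submodule.add_mem _ (hx trivial) (hy trivial)
    | tmul x β => exact hβ a b x β
  refine N.mem_of_single_mem (rg m) (fun a b h => ?_) f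
  clear f
  cases h
  exact fun x => (hγ a b).ge (Submodule.mem_top (x := x))

lemma freeInd_surjective (m : ℕ) : Function.Surjective ((freeInd h₁ h₂ E).f m) := by
  refine mem_of_closed h₁ h₂ E (fun m => LinearMap.range ((freeInd h₁ h₂ E).f m)) ?_ ?_
    (fun e => ⟨_, freeInd_one h₁ h₂ E e⟩) m
  · rintro m _ v ⟨y, rfl⟩
    refine ⟨(Free _ E).act m y (v, 0), ((freeInd h₁ h₂ E).comm m y _).trans ?_⟩
    exact ((ind h₁ h₂ (Free R E)).tot_act m _ _).trans
      ((congrArg (_ + ·) (map_zero ((ind h₁ h₂ (Free R E)).totW m _))).trans (add_zero _))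
  · rintro m _ w ⟨y, rfl⟩
    refine ⟨(Free _ E).act m y (0, w), ((freeInd h₁ h₂ E).comm m y _).trans ?_⟩
    exact ((ind h₁ h₂ (Free R E)).tot_act m _ _).trans
      ((congrArg (· + _) (map_zero ((ind h₁ h₂ (Free R E)).totV m _))).trans (zero_add _))

end Free

end Bigraded

section Bigraded

variable {k : Type} [Field k] {V : Type} [AddCommGroup V] [Module k V]
variable {W : Type} [AddCommGroup W] [Module k W]
variable {R : Submodule k (V ⊗[k] V)} {S : Submodule k (W ⊗[k] W)}
variable {lam : (W ⊗[k] V) →ₗ[k] (V ⊗[k] W)}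

/-- The graded module all of whose components are equal to a given space. -/
def GMod.const {U : Type} [AddCommGroup U] [Module k U] {Q : Submodule k (U ⊗[k] U)} {Z : Type}
    [AddCommGroup Z] [Module k Z] (a : Z →ₗ[k] U →ₗ[k] Z) (h : ∀ z, ∀ r ∈ Q, act2 a a z r = 0) :
    GMod Q := ⟨fun _ => Z, fun _ => a, fun _ => h⟩

section Evaluation

variable {Z : Type} [AddCommGroup Z] [Module k Z] {av : Z →ₗ[k] V →ₗ[k] Z} {aw : Z →ₗ[k] W →ₗ[k] Z}
variable (hv : ∀ z, ∀ r ∈ R, act2 av av z r = 0) (hw : ∀ z, ∀ r ∈ S, act2 aw aw z r = 0)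
variable (h₁ : ∀ s ∈ S, ∀ v, exch1 lam (s ⊗ₜ v) ∈ LinearMap.range (S.subtype.lTensor V))
variable (h₂ : ∀ r ∈ R, ∀ w, exch2 lam (w ⊗ₜ r) ∈ LinearMap.range (R.subtype.rTensor W))
variable {M : GMod R} (φ : GHom M (GMod.const av hv))

/-- The extension of a morphism over the first factor to the components of the induced module. -/
def extComp (a b : ℕ) : M.X a ⊗[k] (Alg S).X b →ₗ[k] Z :=
  ev (GMod.const aw hw) b ∘ₗ (φ.f a).rTensor ((Alg S).X b)

lemma extComp_aone (a : ℕ) (m : M.X a) : extComp hv hw φ a 0 (m ⊗ₜ aone S) = φ.f a m :=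
  ev_one (GMod.const aw hw) (φ.f a m)

lemma extComp_aw (a b : ℕ) (x : M.X a ⊗[k] (Alg S).X b) (w : W) :
    extComp hv hw φ a (b + 1) ((tens (M.X a) (Alg S)).act b x w) = aw (extComp hv hw φ a b x) w := by
  have : extComp hv hw φ a (b + 1) ∘ₗ ((tens (M.X a) (Alg S)).act b).flip w =
      aw.flip w ∘ₗ extComp hv hw φ a b :=
    TensorProduct.ext' fun m β => ev_act (GMod.const aw hw) b (φ.f a m) β w
  exact LinearMap.congr_fun this x

lemma extComp_av (hvw : ∀ z w v, av (aw z w) v = act2 av aw z (lam (w ⊗ₜ v))) (a b : ℕ) (x : M.X a ⊗[k] (Alg S).X b) (v : V) :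
    extComp hv hw φ (a + 1) b (indV h₁ M a b x v) = av (extComp hv hw φ a b x) v := by
  induction x with
  | zero => simp only [map_zero, LinearMap.zero_apply]
  | add x y hx hy => simp only [map_add, LinearMap.add_apply, hx, hy]
  | tmul m β =>
    refine Alg_induction (motive := fun b β => ∀ v, extComp hv hw φ (a + 1) b
      (indV h₁ M a b (m ⊗ₜ β) v) = av (extComp hv hw φ a b (m ⊗ₜ β)) v) ?_ ?_ ?_ b β v
    · intro b x y hx hy v
      simp only [tmul_add, map_add, LinearMap.add_apply, hx, hy]
    · intro c v
      rw [← smul_tmul, indV_aone, extComp_aone, extComp_aone]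
      exact φ.comm a _ v
    · intro b β w hβ v
      refine (congrArg _ (indV_relVW h₁ M a b (m ⊗ₜ β) w v)).trans ?_
      refine Eq.trans ?_ (congrArg (av · v) (extComp_aw hv hw φ a b (m ⊗ₜ β) w)).symm
      rw [hvw]
      exact act2_map_apply _ _ av aw (extComp hv hw φ (a + 1) b) (extComp hv hw φ (a + 1) (b + 1))
        _ _ hβ (extComp_aw hv hw φ (a + 1) b) _

/-- The extension of a morphism over the first factor to the total induced module. -/
def extTot (m : ℕ) : (ind h₁ h₂ M).totX m →ₗ[k] Z :=
  ∑ p ∈ Finset.HasAntidiagonal.antidiagonal m,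
    extComp hv hw φ p.1 p.2 ∘ₗ (ind h₁ h₂ M).comp m p.1 p.2

lemma extTot_apply (m : ℕ) (f : (ind h₁ h₂ M).totX m) : extTot hv hw h₁ h₂ φ m f =
    ∑ p ∈ Finset.HasAntidiagonal.antidiagonal m,
      extComp hv hw φ p.1 p.2 ((ind h₁ h₂ M).comp m p.1 p.2 f) := by
  rw [extTot, LinearMap.sum_apply]
  rfl

lemma extTot_one (x : M.X 0) : extTot hv hw h₁ h₂ φ 0
    ((ind h₁ h₂ M).single (rfl : 0 + 0 = 0) (x ⊗ₜ[k] aone S)) = φ.f 0 x := by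
  rw [extTot_apply, Finset.Nat.antidiagonal_zero, Finset.sum_singleton]
  refine (congrArg (extComp hv hw φ 0 0) (BiMod.comp_single_self _ _ _)).trans ?_
  exact extComp_aone hv hw φ 0 x

lemma extTot_totW (m : ℕ) (f : (ind h₁ h₂ M).totX m) (w : W) :
    extTot hv hw h₁ h₂ φ (m + 1) ((ind h₁ h₂ M).totW m f w) =
      aw (extTot hv hw h₁ h₂ φ m f) w := by
  rw [extTot_apply, extTot_apply, Finset.Nat.sum_antidiagonal_succ', map_sum, LinearMap.sum_apply]
  refine (congrArg₂ _ (map_zero (extComp hv hw φ (m + 1) 0))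
    (Finset.sum_congr rfl fun p _ => ?_)).trans (zero_add _)
  exact extComp_aw hv hw φ p.1 p.2 _ w

lemma extTot_totV (hvw : ∀ z w v, av (aw z w) v = act2 av aw z (lam (w ⊗ₜ v))) (m : ℕ) (f : (ind h₁ h₂ M).totX m) (v : V) :
    extTot hv hw h₁ h₂ φ (m + 1) ((ind h₁ h₂ M).totV m f v) =
      av (extTot hv hw h₁ h₂ φ m f) v := by
  rw [extTot_apply, extTot_apply, Finset.Nat.sum_antidiagonal_succ, map_sum, LinearMap.sum_apply]
  refine (congrArg₂ _ (map_zero (extComp hv hw φ 0 (m + 1)))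
    (Finset.sum_congr rfl fun p _ => ?_)).trans (zero_add _)
  exact extComp_av hv hw h₁ φ hvw p.1 p.2 _ v

end Evaluation

section Free

variable (h₁ : ∀ s ∈ S, ∀ v, exch1 lam (s ⊗ₜ v) ∈ LinearMap.range (S.subtype.lTensor V))
variable (h₂ : ∀ r ∈ R, ∀ w, exch2 lam (w ⊗ₜ r) ∈ LinearMap.range (R.subtype.rTensor W))
variable (E : Type) [AddCommGroup E] [Module k E]

/-- The components of `totExtend`. -/
def totExtendHom (Q : GMod (twRel R S lam)) (g : E →ₗ[k] (constMod Q).X 0) (m : ℕ) :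
    (ind h₁ h₂ (Free R E)).totX m →ₗ[k] (constMod Q).X m :=
  extTot (av := (constMod Q).actV 0) (aw := (constMod Q).actW 0) ((constMod Q).relV 0)
    ((constMod Q).relW 0) h₁ h₂ (freeHom (GMod.const _ ((constMod Q).relV 0)) g) m

/-- The morphism from the total induced module to the product of the components of a module over
the twisted product determined by a linear map. -/
def totExtend (Q : GMod (twRel R S lam)) (g : E →ₗ[k] (constMod Q).X 0) :
    GHom (ind h₁ h₂ (Free R E)).tot (constMod Q) where
  f := totExtendHom h₁ h₂ E Q g
  comm n x u := by
    refine (congrArg (totExtendHom h₁ h₂ E Q g (n + 1)) (BiMod.tot_act _ n x u)).trans ?_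
    refine (map_add (totExtendHom h₁ h₂ E Q g (n + 1)) _ _).trans ?_
    refine Eq.trans ?_ ((constMod Q).act_eq n _ u).symm
    exact congrArg₂ _ (extTot_totV ((constMod Q).relV 0) ((constMod Q).relW 0) h₁ h₂
      (freeHom (GMod.const _ ((constMod Q).relV 0)) g) ((constMod Q).relVW 0) n x u.1)
      (extTot_totW ((constMod Q).relV 0) ((constMod Q).relW 0) h₁ h₂
      (freeHom (GMod.const _ ((constMod Q).relV 0)) g) n x u.2)

lemma totExtendHom_one (Q : GMod (twRel R S lam)) (g : E →ₗ[k] (constMod Q).X 0) (e : E) :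
    totExtendHom h₁ h₂ E Q g 0 ((ind h₁ h₂ (Free R E)).single (rfl : 0 + 0 = 0)
      ((e ⊗ₜ[k] aone R) ⊗ₜ[k] aone S)) =
    (freeHom (GMod.const ((constMod Q).actV 0) ((constMod Q).relV 0)) g).f 0 (e ⊗ₜ[k] aone R) :=
  extTot_one ((constMod Q).relV 0) ((constMod Q).relW 0) h₁ h₂
    (freeHom (GMod.const _ ((constMod Q).relV 0)) g) (e ⊗ₜ[k] aone R)

lemma freeHom_const_one (Q : GMod (twRel R S lam)) (g : E →ₗ[k] (constMod Q).X 0) (e : E) :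
    (freeHom (GMod.const ((constMod Q).actV 0) ((constMod Q).relV 0)) g).f 0 (e ⊗ₜ[k] aone R) =
      g e :=
  freeHom_one (GMod.const ((constMod Q).actV 0) ((constMod Q).relV 0)) g e

lemma totExtend_one (Q : GMod (twRel R S lam)) (g : E →ₗ[k] (constMod Q).X 0) (e : E) :
    (totExtend h₁ h₂ E Q g).f 0 ((ind h₁ h₂ (Free R E)).single (rfl : 0 + 0 = 0)
      ((e ⊗ₜ[k] aone R) ⊗ₜ[k] aone S)) = g e :=
  (totExtendHom_one h₁ h₂ E Q g e).trans (freeHom_const_one E Q g e)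

lemma freeInd_injective (m : ℕ) : Function.Injective ((freeInd h₁ h₂ E).f m) := by
  have key := Free_hom_ext ((totExtend h₁ h₂ E (Free _ E) ((inclConst (Free _ E)).f 0 ∘ₗ
    (TensorProduct.mk k E ((Alg (twRel R S lam)).X 0)).flip (aone _))).comp (freeInd h₁ h₂ E))
    (inclConst (Free _ E)) (fun e => (congrArg _ (freeInd_one h₁ h₂ E e)).trans
      (totExtend_one h₁ h₂ E _ _ e)) m
  have h := inclConst_injective (Free (twRel R S lam) E) m
  rw [← key] at h
  exact Function.Injective.of_comp h

lemma Lin_tot_ind_Free (t : ℕ) : Lin t (ind h₁ h₂ (Free R E)).tot :=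
  (Lin_of_bijective (freeInd h₁ h₂ E) fun m =>
    ⟨freeInd_injective h₁ h₂ E m, freeInd_surjective h₁ h₂ E m⟩).1 (Lin_Free E t)

end Free

end Bigraded

section Bigraded

variable {k : Type} [Field k] {V : Type} [AddCommGroup V] [Module k V]
variable {W : Type} [AddCommGroup W] [Module k W]
variable {R : Submodule k (V ⊗[k] V)} {S : Submodule k (W ⊗[k] W)}
variable {lam : (W ⊗[k] V) →ₗ[k] (V ⊗[k] W)}

namespace BiMod

variable {N N' : BiMod R S lam}

/-- The map of total modules induced by maps of components. -/
def totMap (g : ∀ a b, N.X a b →ₗ[k] N'.X a b) (m : ℕ) : N.totX m →ₗ[k] N'.totX m where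
  toFun f := ⟨fun a b => g a b (f.1 a b), fun a b h =>
    (congrArg (g a b) (f.2 a b h)).trans (map_zero _)⟩
  map_add' _ _ := Subtype.ext (funext fun a => funext fun b => map_add (g a b) _ _)
  map_smul' _ _ := Subtype.ext (funext fun a => funext fun b => map_smul (g a b) _ _)

/-- The family obtained by applying maps which raise the first degree by one. -/
def famShift (g : ∀ a b, N.X a b →ₗ[k] N'.X (a + 1) b) (f : ∀ a b, N.X a b) : ∀ a b, N'.X a b
  | 0, _ => 0
  | a + 1, b => g a b (f a b)

/-- The map of total modules induced by maps of components raising the first degree by one. -/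
def totShift (g : ∀ a b, N.X a b →ₗ[k] N'.X (a + 1) b) (m : ℕ) :
    N.totX m →ₗ[k] N'.totX (m + 1) where
  toFun f := ⟨famShift g f.1, by
    rintro (_ | a) b h
    · rfl
    · exact (congrArg (g a b) (f.2 a b (by omega))).trans (map_zero _)⟩
  map_add' f f' := Subtype.ext (funext fun a => funext fun b => by
    cases a
    · exact (add_zero _).symm
    · exact map_add (g _ b) _ _)
  map_smul' c f := Subtype.ext (funext fun a => funext fun b => by
    cases a
    · exact (smul_zero c).symm
    · exact map_smul (g _ b) _ _)

/-- A choice of a family with prescribed properties. -/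
lemma exists_totX (m : ℕ) (p : ∀ a b, N.X a b → Prop) (h : ∀ a b, a + b = m → ∃ x, p a b x) :
    ∃ f : N.totX m, ∀ a b, a + b = m → p a b (N.comp m a b f) := by
  have : ∀ a b, ∃ x : N.X a b, (a + b = m → p a b x) ∧ (a + b ≠ m → x = 0) := by
    intro a b
    by_cases hab : a + b = m
    · obtain ⟨x, hx⟩ := h a b hab
      exact ⟨x, fun _ => hx, fun h' => absurd hab h'⟩
    · exact ⟨0, fun h' => absurd h' hab, fun _ => rfl⟩
  choose f hf using this
  exact ⟨⟨f, fun a b => (hf a b).2⟩, fun a b => (hf a b).1⟩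

lemma totMap_surjective (g : ∀ a b, N.X a b →ₗ[k] N'.X a b)
    (h : ∀ a b, Function.Surjective (g a b)) (m : ℕ) : Function.Surjective (totMap g m) := by
  intro y
  obtain ⟨f, hf⟩ := N.exists_totX m (fun a b x => g a b x = N'.comp m a b y)
    fun a b _ => h a b _
  exact ⟨f, N'.totX_ext hf⟩

lemma mem_range_totShift {g : ∀ a b, N.X a b →ₗ[k] N'.X (a + 1) b} {m : ℕ} {y : N'.totX (m + 1)}
    (h₀ : N'.comp (m + 1) 0 (m + 1) y = 0)
    (h : ∀ a b, N'.comp (m + 1) (a + 1) b y ∈ Set.range (g a b)) :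
    y ∈ Set.range (totShift g m) := by
  obtain ⟨f, hf⟩ := N.exists_totX m (fun a b x => g a b x = N'.comp (m + 1) (a + 1) b y)
    fun a b _ => h a b
  refine ⟨f, N'.totX_ext fun a b hab => ?_⟩
  match a with
  | 0 =>
    obtain rfl : b = m + 1 := by omega
    exact h₀.symm
  | a + 1 => exact hf a b (by omega)

lemma totMap_tot_act (g : ∀ a b, N.X a b →ₗ[k] N'.X a b)
    (hv : ∀ a b x v, g (a + 1) b (N.av a b x v) = N'.av a b (g a b x) v)
    (hw : ∀ a b x w, g a (b + 1) (N.aw a b x w) = N'.aw a b (g a b x) w)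
    (m : ℕ) (f : N.totX m) (u : V × W) :
    totMap g (m + 1) (N.tot.act m f u) = N'.tot.act m (totMap g m f) u := by
  refine (congrArg (totMap g (m + 1)) (N.tot_act m f u)).trans ?_
  refine (map_add (totMap g (m + 1)) _ _).trans ?_
  refine Eq.trans ?_ (N'.tot_act m _ u).symm
  refine congrArg₂ _ (N'.totX_ext fun a b _ => ?_) (N'.totX_ext fun a b _ => ?_)
  · match a with
    | 0 => exact map_zero (g 0 b)
    | a + 1 => exact hv a b _ _
  · match b with
    | 0 => exact map_zero (g a 0)
    | b + 1 => exact hw a b _ _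

lemma totShift_tot_act (g : ∀ a b, N.X a b →ₗ[k] N'.X (a + 1) b)
    (hv : ∀ a b x v, g (a + 1) b (N.av a b x v) = N'.av (a + 1) b (g a b x) v)
    (hw : ∀ a b x w, g a (b + 1) (N.aw a b x w) = N'.aw (a + 1) b (g a b x) w)
    (m : ℕ) (f : N.totX m) (u : V × W) :
    totShift g (m + 1) (N.tot.act m f u) = N'.tot.act (m + 1) (totShift g m f) u := by
  refine (congrArg (totShift g (m + 1)) (N.tot_act m f u)).trans ?_
  refine (map_add (totShift g (m + 1)) _ _).trans ?_
  refine Eq.trans ?_ (N'.tot_act (m + 1) _ u).symm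
  refine congrArg₂ _ (N'.totX_ext fun a b _ => ?_) (N'.totX_ext fun a b _ => ?_)
  · match a with
    | 0 => rfl
    | 1 =>
      refine (map_zero (g 0 b)).trans ?_
      exact ((LinearMap.congr_fun (map_zero (N'.av 0 b)) u.1).trans rfl).symm
    | a + 2 => exact hv a b _ _
  · match a, b with
    | 0, 0 => rfl
    | 0, b + 1 => exact ((LinearMap.congr_fun (map_zero (N'.aw 0 b)) u.2).trans rfl).symm
    | a + 1, 0 => exact map_zero (g a 0)
    | a + 1, b + 1 => exact hw a b _ _

end BiMod

section Induction

variable (h₁ : ∀ s ∈ S, ∀ v, exch1 lam (s ⊗ₜ v) ∈ LinearMap.range (S.subtype.lTensor V))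
variable (h₂ : ∀ r ∈ R, ∀ w, exch2 lam (w ⊗ₜ r) ∈ LinearMap.range (R.subtype.rTensor W))

lemma rTensor_indV {M M' : GMod R} {a a' : ℕ} (f₀ : M.X a →ₗ[k] M'.X a')
    (f₁ : M.X (a + 1) →ₗ[k] M'.X (a' + 1)) (h : ∀ m v, f₁ (M.act a m v) = M'.act a' (f₀ m) v)
    (b : ℕ) (x : M.X a ⊗[k] (Alg S).X b) (v : V) :
    f₁.rTensor ((Alg S).X b) (indV h₁ M a b x v) = indV h₁ M' a' b (f₀.rTensor _ x) v := by
  induction x with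
  | zero => simp only [map_zero, LinearMap.zero_apply]
  | add x y hx hy => simp only [map_add, LinearMap.add_apply, hx, hy]
  | tmul m β =>
    rw [LinearMap.rTensor_tmul, indV_tmul, indV_tmul, ← LinearMap.comp_apply,
      ← LinearMap.rTensor_comp]
    exact congrArg (fun g => LinearMap.rTensor ((Alg S).X b) g (lamB h₁ b β v))
      (LinearMap.ext (h m))

/-- The map of total induced modules induced by a linear differential. -/
def indShift {M M' : GMod R} (d : ∀ n, M.X n →ₗ[k] M'.X (n + 1)) :
    ∀ m, (ind h₁ h₂ M).totX m →ₗ[k] (ind h₁ h₂ M').totX (m + 1) :=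
  BiMod.totShift (N := ind h₁ h₂ M) (N' := ind h₁ h₂ M')
    fun a b => (d a).rTensor ((Alg S).X b)

/-- The morphism of total induced modules induced by a morphism. -/
def indHom {M M' : GMod R} (ε : GHom M M') : GHom (ind h₁ h₂ M).tot (ind h₁ h₂ M').tot where
  f := BiMod.totMap (N := ind h₁ h₂ M) (N' := ind h₁ h₂ M')
    fun a b => (ε.f a).rTensor ((Alg S).X b)
  comm := BiMod.totMap_tot_act (N := ind h₁ h₂ M) (N' := ind h₁ h₂ M') _
    (fun a b x v => rTensor_indV h₁ (ε.f a) (ε.f (a + 1)) (ε.comm a) b x v)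
    (fun a b x w => (mapTens (ε.f a) (Alg S)).comm b x w)

lemma Resolution.ind {C : ℕ → GMod R} {d : ∀ j n, (C (j + 1)).X n →ₗ[k] (C j).X (n + 1)}
    {M : GMod R} {ε : GHom (C 0) M} (h : Resolution C d ε) :
    Resolution (fun j => (ind h₁ h₂ (C j)).tot) (fun j => indShift h₁ h₂ (d j))
      (indHom h₁ h₂ ε) where
  comm j := BiMod.totShift_tot_act (N := QuadraticKoszul.ind h₁ h₂ (C (j + 1)))
    (N' := QuadraticKoszul.ind h₁ h₂ (C j)) _
    (fun a b x v => rTensor_indV h₁ (d j a) (d j (a + 1)) (h.comm j a) b x v)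
    (fun a b x w => (mapTens (d j a) (Alg S)).comm b x w)
  surj := BiMod.totMap_surjective (N := QuadraticKoszul.ind h₁ h₂ (C 0))
    (N' := QuadraticKoszul.ind h₁ h₂ M) _ fun a b => LinearMap.rTensor_surjective _ (h.surj a)
  inj_zero := by
    intro x y hxy
    refine BiMod.totX_ext _ fun a b hab => ?_
    obtain ⟨rfl, rfl⟩ : a = 0 ∧ b = 0 := by omega
    exact Module.Flat.rTensor_preserves_injective_linearMap _ h.inj_zero
      (congrArg ((QuadraticKoszul.ind h₁ h₂ M).comp 0 0 0) hxy)
  exact_zero n y := by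
    constructor
    · intro hy
      have hy' : ∀ a b, (ε.f a).rTensor ((Alg S).X b)
          ((QuadraticKoszul.ind h₁ h₂ (C 0)).comp (n + 1) a b y) = 0 := fun a b =>
        congrArg ((QuadraticKoszul.ind h₁ h₂ M).comp (n + 1) a b) hy
      refine BiMod.mem_range_totShift ?_ fun a b => ?_
      · exact Module.Flat.rTensor_preserves_injective_linearMap _ h.inj_zero
          ((hy' 0 _).trans (map_zero _).symm)
      · exact (Module.Flat.rTensor_exact _ (h.exact_zero a) _).1 (hy' (a + 1) b)
    · rintro ⟨x, rfl⟩
      refine BiMod.totX_ext (QuadraticKoszul.ind h₁ h₂ M) fun a b _ => ?_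
      match a with
      | 0 => exact map_zero ((ε.f 0).rTensor ((Alg S).X b))
      | a + 1 => exact (Module.Flat.rTensor_exact _ (h.exact_zero a) _).2 ⟨_, rfl⟩
  inj_succ j := by
    intro x y hxy
    refine BiMod.totX_ext _ fun a b hab => ?_
    obtain ⟨rfl, rfl⟩ : a = 0 ∧ b = 0 := by omega
    exact Module.Flat.rTensor_preserves_injective_linearMap _ (h.inj_succ j)
      (congrArg ((QuadraticKoszul.ind h₁ h₂ (C j)).comp 1 1 0) hxy)
  exact_succ j n y := by
    constructor
    · intro hy
      have hy' : ∀ a b, (d j a).rTensor ((Alg S).X b)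
          ((QuadraticKoszul.ind h₁ h₂ (C (j + 1))).comp (n + 1) a b y) = 0 := fun a b =>
        congrArg ((QuadraticKoszul.ind h₁ h₂ (C j)).comp (n + 2) (a + 1) b) hy
      refine BiMod.mem_range_totShift ?_ fun a b => ?_
      · exact Module.Flat.rTensor_preserves_injective_linearMap _ (h.inj_succ j)
          ((hy' 0 _).trans (map_zero _).symm)
      · exact (Module.Flat.rTensor_exact _ (h.exact_succ j a) _).1 (hy' (a + 1) b)
    · rintro ⟨x, rfl⟩
      refine BiMod.totX_ext (QuadraticKoszul.ind h₁ h₂ (C j)) fun a b _ => ?_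
      match a with
      | 0 => rfl
      | 1 => exact map_zero ((d j 0).rTensor ((Alg S).X b))
      | a + 2 => exact (Module.Flat.rTensor_exact _ (h.exact_succ j a) _).2 ⟨_, rfl⟩

end Induction

end Bigraded

section Bigraded

variable {k : Type} [Field k] {V : Type} [AddCommGroup V] [Module k V]
variable {W : Type} [AddCommGroup W] [Module k W]
variable {R : Submodule k (V ⊗[k] V)} {S : Submodule k (W ⊗[k] W)}
variable {lam : (W ⊗[k] V) →ₗ[k] (V ⊗[k] W)}

section Inflation

variable (R lam) in
/-- A graded module over the second factor, with trivial action of the first factor. -/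
def infl (M : GMod S) : GMod (twRel R S lam) :=
  GMod.ofVW M.X 0 M.act
    (fun _ x r _ => act2_eq_zero 0 0 LinearMap.id x (fun _ _ => rfl) r) M.rel
    (fun _ x w v => (act2_eq_zero 0 _ LinearMap.id x
      (fun _ _ => (LinearMap.congr_fun (map_zero (M.act _)) _).trans rfl) (lam (w ⊗ₜ v))).symm)

lemma infl_act (M : GMod S) (n : ℕ) (x : M.X n) (u : V × W) :
    (infl R lam M).act n x u = M.act n x u.2 := zero_add _

variable (R lam) in
/-- The functoriality of inflation. -/
def inflHom {M N : GMod S} (φ : GHom M N) : GHom (infl R lam M) (infl R lam N) where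
  f := φ.f
  comm n x u := (congrArg (φ.f (n + 1)) (infl_act M n x u)).trans
    ((φ.comm n x u.2).trans (infl_act N n _ u).symm)

lemma Resolution.infl {C : ℕ → GMod S} {d : ∀ j n, (C (j + 1)).X n →ₗ[k] (C j).X (n + 1)}
    {M : GMod S} {ε : GHom (C 0) M} (h : Resolution C d ε) :
    Resolution (fun j => infl R lam (C j)) d (inflHom R lam ε) where
  comm j n x u := (congrArg (d j (n + 1)) (infl_act (C (j + 1)) n x u)).trans
    ((h.comm j n x u.2).trans (infl_act (C j) (n + 1) _ u).symm)
  surj := h.surj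
  inj_zero := h.inj_zero
  exact_zero := h.exact_zero
  inj_succ := h.inj_succ
  exact_succ := h.exact_succ

variable (R lam) in
/-- Inflation commutes with the formation of copower. -/
def tensInfl (E : Type) [AddCommGroup E] [Module k E] (M : GMod S) :
    GHom (tens E (infl R lam M)) (infl R lam (tens E M)) :=
  GHom.ofTens (fun _ => LinearMap.id) fun n e m u =>
    (congrArg (fun z => (e ⊗ₜ[k] z : E ⊗[k] M.X (n + 1))) (infl_act M n m u)).trans
      (infl_act (tens E M) n (e ⊗ₜ[k] m : E ⊗[k] M.X n) u).symm

variable (R S lam) in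
/-- The inflation of a trivial module is trivial. -/
def inflTriv (E : Type) [AddCommGroup E] [Module k E] :
    GHom (infl R lam (trivMod S E)) (trivMod (twRel R S lam) E) where
  f _ := LinearMap.id
  comm _ _ _ := (Subsingleton.elim (α := PUnit) _ _)

end Inflation

section Trivial

variable (h₁ : ∀ s ∈ S, ∀ v, exch1 lam (s ⊗ₜ v) ∈ LinearMap.range (S.subtype.lTensor V))
variable (h₂ : ∀ r ∈ R, ∀ w, exch2 lam (w ⊗ₜ r) ∈ LinearMap.range (R.subtype.rTensor W))

/-- The component of first degree zero of the module induced from the trivial module. -/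
def indTrivComp (m : ℕ) : (trivMod R k).X 0 ⊗[k] (Alg S).X m ≃ₗ[k] (Alg S).X m :=
  TensorProduct.lid k ((Alg S).X m)

/-- The module induced from the trivial module is the inflation of the second factor. -/
def indTriv : GHom (ind h₁ h₂ (trivMod R k)).tot (infl R lam (Alg S)) where
  f m := (indTrivComp (R := R) m).toLinearMap ∘ₗ (ind h₁ h₂ (trivMod R k)).comp m 0 m
  comm m x u := by
    refine Eq.trans ?_ (infl_act (Alg S) m _ u).symm
    refine (congrArg (indTrivComp (R := R) (m + 1))
      (zero_add ((ind h₁ h₂ (trivMod R k)).aw 0 m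
        ((ind h₁ h₂ (trivMod R k)).comp m 0 m x) u.2))).trans ?_
    have : (indTrivComp (R := R) (m + 1)).toLinearMap ∘ₗ
        ((tens ((trivMod R k).X 0) (Alg S)).act m).flip u.2 =
        ((Alg S).act m).flip u.2 ∘ₗ (indTrivComp (R := R) m).toLinearMap :=
      TensorProduct.ext' fun (c : k) β =>
        (LinearMap.congr_fun (map_smul ((Alg S).act m) (c : k) β) u.2).symm
    exact LinearMap.congr_fun this _

lemma subsingleton_trivMod_tensor (a : ℕ) (P : Type) [AddCommGroup P] [Module k P]
    (x : (trivMod R k).X (a + 1) ⊗[k] P) : x = 0 := by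
  induction x with
  | zero => rfl
  | add x y hx hy => rw [hx, hy, add_zero]
  | tmul c p =>
    rw [(trivMod_subsingleton (R := R) k a).elim c 0, zero_tmul]

lemma indTriv_bijective (m : ℕ) : Function.Bijective ((indTriv h₁ h₂).f m) := by
  constructor
  · intro x y hxy
    refine BiMod.totX_ext _ fun a b hab => ?_
    match a with
    | 0 =>
      obtain rfl : b = m := by omega
      exact (indTrivComp (R := R) b).injective hxy
    | a + 1 =>
      exact (subsingleton_trivMod_tensor a _ _).trans (subsingleton_trivMod_tensor a _ _).symm
  · intro y
    refine ⟨(ind h₁ h₂ (trivMod R k)).single (zero_add m) ((indTrivComp (R := R) m).symm y), ?_⟩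
    exact (congrArg (indTrivComp (R := R) m) (BiMod.comp_single_self _ _ _)).trans
      ((indTrivComp (R := R) m).apply_symm_apply y)

end Trivial

lemma isKoszul_twRel
    (h₁ : ∀ s ∈ S, ∀ v, exch1 lam (s ⊗ₜ v) ∈ LinearMap.range (S.subtype.lTensor V))
    (h₂ : ∀ r ∈ R, ∀ w, exch2 lam (w ⊗ₜ r) ∈ LinearMap.range (R.subtype.rTensor W))
    (hA : IsKoszul k V (R.map (toTP2 k V).toLinearMap))
    (hB : IsKoszul k W (S.map (toTP2 k W).toLinearMap)) :
    IsKoszul k (V × W) ((twRel R S lam).map (toTP2 k (V × W)).toLinearMap) := by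
  have hAlg : ∀ t, Lin t (infl R lam (Alg S)) := fun t =>
    (Lin_of_bijective (indTriv h₁ h₂) (indTriv_bijective h₁ h₂)).1
      (((QuadraticKoszul.IsKoszul.resolution hA).ind h₁ h₂).lin
        (fun j t => Lin_tot_ind_Free h₁ h₂ (Kd R j) t) t)
  refine isKoszul_of_lin fun t => (Lin_of_bijective (inflTriv R S lam k)
    fun n => Function.bijective_id).1 ?_
  refine (QuadraticKoszul.IsKoszul.resolution hB).infl.lin (fun j t => ?_) t
  exact (Lin_of_bijective (tensInfl R lam (Kd S j) (Alg S)) fun n => Function.bijective_id).1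
    ((hAlg t).tens (Kd S j))

end Bigraded

end QuadraticKoszul

/-- **Koszulness and replacement rules.**  If `V` and `W` are finite dimensional, `λ` is a
replacement rule, and `A = T(V)/(R)` and `B = T(W)/(S)` are Koszul, then
`P = T(V⊕W)/(R ⊕ D_λ ⊕ S)` is Koszul. -/
theorem statement13 [FiniteDimensional k V] [FiniteDimensional k W]
    (hrr : IsReplacementRule k V W R S lam)
    (hA : IsKoszul k V (Submodule.map (toTP2 k V).toLinearMap R))
    (hB : IsKoszul k W (Submodule.map (toTP2 k W).toLinearMap S)) :
    IsKoszul k (V × W) (relP k V W R S lam) := by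
  rw [QuadraticKoszul.relP_eq_map]
  exact QuadraticKoszul.isKoszul_twRel (QuadraticKoszul.exch1_mem hrr)
    (QuadraticKoszul.exch2_mem hrr) hA hB

end Quadratic
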